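/- arXiv:math/0608159 — 2 statements merged into one kernel-verified Lean document; each statement's English description precedes it below -/
import Mathlib

section
/- Let Γ be a SH rooted tree of type {L_n, k_n} with sup_n k_n < ∞, so that the adjacency Laplacian Δ is a bounded self-adjoint operator on ℓ²(V(Γ)). For a vertex v, let δ_v ∈ ℓ²(V(Γ)) be the delta function at v and μ_v the spectral measure of Δ and δ_v. Let (a,b) ⊂ ℝ be an open interval such that the restriction of μ_O to (a,b) is singular with respect to Lebesgue measure, where O is the root (i.e., the absolutely continuous part of μ_O vanishes on (a,b)). Then for every vertex v of Γ, the restriction of μ_v to (a,b) is singular with respect to Lebesgue measure. -/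
open MeasureTheory Filter
open scoped ENNReal RealInnerProductSpace

/-- A holomorphic map from the open upper half plane to itself. -/
structure IsHerglotz (F : ℂ → ℂ) : Prop where
  differentiableOn : DifferentiableOn ℂ F {z | 0 < z.im}
  im_pos : ∀ z : ℂ, 0 < z.im → 0 < (F z).im

namespace IsHerglotz

variable {F : ℂ → ℂ}

lemma ne_zero (hF : IsHerglotz F) {z : ℂ} (hz : 0 < z.im) : F z ≠ 0 := by
  intro h
  have := hF.im_pos z hz
  simp [h] at this

lemma neg_inv (hF : IsHerglotz F) : IsHerglotz fun z => -(F z)⁻¹ where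
  differentiableOn := (hF.differentiableOn.inv fun _ hz => hF.ne_zero hz).neg
  im_pos z hz := by
    have h : 0 < Complex.normSq (F z) := Complex.normSq_pos.2 (hF.ne_zero hz)
    have := hF.im_pos z hz
    simp only [Complex.neg_im, Complex.inv_im]
    rw [neg_div, neg_neg]
    positivity

lemma one_lt_norm_add_I (hF : IsHerglotz F) {z : ℂ} (hz : 0 < z.im) :
    1 < ‖F z + Complex.I‖ := by
  have h := hF.im_pos z hz
  have h2 := Complex.abs_im_le_norm (F z + Complex.I)
  have h3 := le_abs_self (F z + Complex.I).im
  simp only [Complex.add_im, Complex.I_im] at h2 h3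
  linarith

lemma differentiableOn_log (hF : IsHerglotz F) :
    DifferentiableOn ℂ (fun z => Complex.log (F z + Complex.I)) {z | 0 < z.im} := by
  refine (hF.differentiableOn.add_const _).clog fun z hz => ?_
  refine Complex.mem_slitPlane_iff.2 (Or.inr (ne_of_gt ?_))
  have := hF.im_pos z hz
  simp only [Complex.add_im, Complex.I_im]
  positivity

lemma continuous_log_norm (hF : IsHerglotz F) {ε : ℝ} (hε : 0 < ε) :
    Continuous fun x : ℝ => Real.log ‖F (x + ε * Complex.I) + Complex.I‖ := by
  have hc : Continuous fun x : ℝ => Complex.log (F (x + ε * Complex.I) + Complex.I) :=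
    hF.differentiableOn_log.continuousOn.comp_continuous (by fun_prop) (by simp [hε])
  simpa only [Function.comp_def, Complex.log_re] using Complex.continuous_re.comp hc

/-- A Kolmogorov-type estimate, obtained by integrating `log (F + i)` around a rectangle. -/
lemma integral_log_norm_le (hF : IsHerglotz F) {a b ε : ℝ} (hε : 0 < ε) (hε1 : ε ≤ 1) :
    ∫ x in a..b, Real.log ‖F (x + ε * Complex.I) + Complex.I‖ ≤
      (∫ x in a..b, Real.log ‖F (x + Complex.I) + Complex.I‖) + 2 * Real.pi := by
  set g : ℂ → ℂ := fun z => Complex.log (F z + Complex.I) with hg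
  have hgc : ContinuousOn g {z | 0 < z.im} := hF.differentiableOn_log.continuousOn
  have hrect := Complex.integral_boundary_rect_eq_zero_of_differentiableOn g
    (a + ε * Complex.I) (b + 1 * Complex.I) (hF.differentiableOn_log.mono ?_)
  swap
  · intro z hz
    have h := hz.2
    simp only [Set.mem_preimage] at h
    simp only [Complex.add_im, Complex.ofReal_im, Complex.mul_im, Complex.ofReal_re,
      Complex.I_im, Complex.I_re, Complex.one_re, Complex.one_im] at h
    norm_num at h
    rw [Set.uIcc_of_le hε1] at h
    exact hε.trans_le h.1
  simp only [Complex.add_im, Complex.add_re, Complex.ofReal_im, Complex.ofReal_re, Complex.mul_im,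
    Complex.mul_re, Complex.I_im, Complex.I_re, Complex.one_re, Complex.one_im] at hrect
  norm_num at hrect
  have hcx : ∀ δ : ℝ, 0 < δ → Continuous fun x : ℝ => g (x + δ * Complex.I) := fun δ hδ =>
    hgc.comp_continuous (by fun_prop) (by simp [hδ])
  have hre : ∀ δ : ℝ, 0 < δ → (∫ x in a..b, g (x + δ * Complex.I)).re =
      ∫ x in a..b, Real.log ‖F (x + δ * Complex.I) + Complex.I‖ := by
    intro δ hδ
    have := Complex.reCLM.intervalIntegral_comp_comm
      ((hcx δ hδ).intervalIntegrable (μ := volume) a b)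
    simp only [Complex.reCLM_apply] at this
    rw [← this]
    simp [hg, Complex.log_re]
  have him : ∀ c : ℝ, |(∫ y in ε..1, g (c + y * Complex.I)).im| ≤ Real.pi := by
    intro c
    have hi : IntervalIntegrable (fun y : ℝ => g (c + y * Complex.I)) volume ε 1 := by
      refine ContinuousOn.intervalIntegrable (hgc.comp (by fun_prop) ?_)
      intro y hy
      rw [Set.uIcc_of_le hε1] at hy
      simpa using hε.trans_le hy.1
    have h1 := Complex.imCLM.intervalIntegral_comp_comm hi
    simp only [Complex.imCLM_apply] at h1
    rw [← h1, ← Real.norm_eq_abs]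
    refine (intervalIntegral.norm_integral_le_of_norm_le_const (C := Real.pi)
      fun y _ => ?_).trans ?_
    · simpa [hg, Complex.log_im] using Complex.abs_arg_le_pi _
    · rw [abs_of_nonneg (by linarith)]
      nlinarith [Real.pi_pos]
  have h0 := congrArg Complex.re hrect
  have e1 := hre 1 one_pos
  simp only [Complex.ofReal_one, one_mul] at e1
  simp only [Complex.sub_re, Complex.add_re, Complex.mul_re, Complex.I_re, Complex.I_im, zero_mul,
    one_mul, Complex.zero_re, hre ε hε, e1] at h0
  have ha := abs_le.1 (him a)
  have hb := abs_le.1 (him b)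
  linarith [ha.1, ha.2, hb.1, hb.2]

end IsHerglotz

/-- Finitely many Herglotz functions are, at almost every point of a bounded interval,
simultaneously bounded along a subsequence of vertical approach. -/
lemma ae_frequently_norm_le_of_isHerglotz (𝓕 : List (ℂ → ℂ)) (h𝓕 : ∀ F ∈ 𝓕, IsHerglotz F)
    (a b : ℝ) :
    ∀ᵐ x : ℝ ∂volume.restrict (Set.Ioo a b), ∃ M : ℝ, ∃ᶠ n : ℕ in atTop,
      ∀ F ∈ 𝓕, ‖F (x + ((1 / ((n : ℝ) + 1) : ℝ) : ℂ) * Complex.I)‖ ≤ M := by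
  rcases le_or_gt b a with hab | hab
  · simp [Set.Ioo_eq_empty_of_le hab]
  let l (F : ℂ → ℂ) (n : ℕ) (x : ℝ) : ℝ :=
    Real.log ‖F (x + ((1 / ((n : ℝ) + 1) : ℝ) : ℂ) * Complex.I) + Complex.I‖
  have hεpos : ∀ n : ℕ, 0 < 1 / ((n : ℝ) + 1) := fun n => by positivity
  have hεle : ∀ n : ℕ, 1 / ((n : ℝ) + 1) ≤ 1 := fun n => by
    rw [div_le_one (by positivity)]; linarith [(Nat.cast_nonneg n : (0 : ℝ) ≤ n)]
  have him : ∀ (n : ℕ) (x : ℝ), 0 < (x + ((1 / ((n : ℝ) + 1) : ℝ) : ℂ) * Complex.I).im :=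
    fun n x => by rw [Complex.add_im, Complex.im_ofReal_mul]; simpa using hεpos n
  have hlpos : ∀ F ∈ 𝓕, ∀ n x, 0 ≤ l F n x := fun F hF n x =>
    Real.log_nonneg ((h𝓕 F hF).one_lt_norm_add_I (him n x)).le
  have hlc : ∀ F ∈ 𝓕, ∀ n, Continuous (l F n) := fun F hF n =>
    (h𝓕 F hF).continuous_log_norm (hεpos n)
  let S (n : ℕ) (x : ℝ) : ℝ := (𝓕.map fun F => l F n x).sum
  have key : ∀ 𝓖 : List (ℂ → ℂ), (∀ F ∈ 𝓖, F ∈ 𝓕) →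
      (∀ n, Continuous fun x => (𝓖.map fun F => l F n x).sum) ∧
      (∀ n x, ∀ F ∈ 𝓖, l F n x ≤ (𝓖.map fun F => l F n x).sum) ∧
      (∀ n x, 0 ≤ (𝓖.map fun F => l F n x).sum) ∧
      ∃ C, ∀ n, ∫ x in a..b, (𝓖.map fun F => l F n x).sum ≤ C := by
    intro 𝓖
    induction 𝓖 with
    | nil => intro _; exact ⟨by simp [continuous_const], by simp, by simp, 0, by simp⟩
    | cons F 𝓖 ih =>
      intro h
      obtain ⟨h1, h2, h3, C, hC⟩ := ih fun G hG => h G (List.mem_cons_of_mem _ hG)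
      have hF := h F List.mem_cons_self
      refine ⟨fun n => ?_, fun n x G hG => ?_, fun n x => ?_,
        (∫ x in a..b, Real.log ‖F (x + Complex.I) + Complex.I‖) + 2 * Real.pi + C, fun n => ?_⟩
      · simp only [List.map_cons, List.sum_cons]
        exact (hlc F hF n).add (h1 n)
      · simp only [List.map_cons, List.sum_cons]
        rcases List.mem_cons.1 hG with rfl | hG
        · linarith [h3 n x]
        · linarith [h2 n x G hG, hlpos F hF n x]
      · simp only [List.map_cons, List.sum_cons]
        linarith [h3 n x, hlpos F hF n x]
      · simp only [List.map_cons, List.sum_cons]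
        rw [intervalIntegral.integral_add ((hlc F hF n).intervalIntegrable _ _)
          ((h1 n).intervalIntegrable _ _)]
        exact add_le_add ((h𝓕 F hF).integral_log_norm_le (hεpos n) (hεle n)) (hC n)
  obtain ⟨hSc, hSle, hS0, C, hC⟩ := key 𝓕 fun _ => id
  have hlint : ∀ n, ∫⁻ x in Set.Ioo a b, ENNReal.ofReal (S n x) ≤ ENNReal.ofReal C := by
    intro n
    rw [← ofReal_integral_eq_lintegral_ofReal]
    · refine ENNReal.ofReal_le_ofReal ?_
      rw [← integral_Ioc_eq_integral_Ioo, ← intervalIntegral.integral_of_le hab.le]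
      exact hC n
    · exact ((hSc n).integrableOn_Icc (a := a) (b := b)).mono_set Set.Ioo_subset_Icc_self
    · exact Eventually.of_forall (hS0 n)
  have hfatou : ∫⁻ x in Set.Ioo a b, liminf (fun n => ENNReal.ofReal (S n x)) atTop < ∞ := by
    refine (lintegral_liminf_le fun n => (hSc n).measurable.ennreal_ofReal).trans_lt ?_
    refine lt_of_le_of_lt ?_ (ENNReal.ofReal_lt_top (r := C))
    exact liminf_le_of_frequently_le' (Frequently.of_forall hlint)
  have hae := ae_lt_top (Measurable.liminf fun n => (hSc n).measurable.ennreal_ofReal) hfatou.ne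
  filter_upwards [hae] with x hx
  obtain ⟨R, hR1, hR2⟩ := exists_between hx
  have hfr := frequently_lt_of_liminf_lt (by isBoundedDefault) hR1
  refine ⟨Real.exp R.toReal + 1, hfr.mono fun n hn F hF => ?_⟩
  have hn' : S n x ≤ R.toReal := (ENNReal.ofReal_le_iff_le_toReal hR2.ne).1 hn.le
  have h1 : l F n x ≤ R.toReal := (hSle n x F hF).trans hn'
  set w := F (x + ((1 / ((n : ℝ) + 1) : ℝ) : ℂ) * Complex.I) with hw
  have h2 : ‖w + Complex.I‖ ≤ Real.exp R.toReal := by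
    rw [← Real.log_le_iff_le_exp]
    · exact h1
    · exact one_pos.trans ((h𝓕 F hF).one_lt_norm_add_I (him n x))
  calc ‖w‖ = ‖(w + Complex.I) - Complex.I‖ := by simp
    _ ≤ ‖w + Complex.I‖ + ‖Complex.I‖ := norm_sub_le _ _
    _ ≤ _ := by simpa using h2

section Green

variable {H : Type*} [NormedAddCommGroup H] [InnerProductSpace ℂ H] [CompleteSpace H]

/-- The diagonal Green function `⟨e, (A - z)⁻¹ e⟩`. -/
noncomputable def green (A : H →L[ℂ] H) (e : H) (z : ℂ) : ℂ :=
  -inner ℂ e (resolvent A z e)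

variable {A A' : H →L[ℂ] H}

lemma mem_resolventSet_of_isSelfAdjoint (hA : IsSelfAdjoint A) {z : ℂ} (hz : z.im ≠ 0) :
    z ∈ resolventSet ℂ A := by
  by_contra h
  exact hz (hA.im_eq_zero_of_mem_spectrum h)

lemma smul_sub_resolvent_apply (hA : IsSelfAdjoint A) {z : ℂ} (hz : z.im ≠ 0) (e : H) :
    z • resolvent A z e - A (resolvent A z e) = e := by
  have h := Ring.mul_inverse_cancel _ (mem_resolventSet_of_isSelfAdjoint hA hz)
  simpa [resolvent, Algebra.algebraMap_eq_smul_one] using congrArg (fun T : H →L[ℂ] H => T e) h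

lemma eq_resolvent_apply (hA : IsSelfAdjoint A) {z : ℂ} (hz : z.im ≠ 0) {u e : H}
    (h : z • u - A u = e) : u = resolvent A z e := by
  have h' := Ring.inverse_mul_cancel _ (mem_resolventSet_of_isSelfAdjoint hA hz)
  have h₁ : (algebraMap ℂ (H →L[ℂ] H) z - A) u = e := by
    rw [← h]
    simp [Algebra.algebraMap_eq_smul_one]
  rw [resolvent, ← h₁, ← mul_apply_eq_comp, h', one_apply_eq_self]

lemma inner_apply_comm (hA : IsSelfAdjoint A) (u w : H) :
    inner ℂ (A u) w = inner ℂ u (A w) := hA.isSymmetric u w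

lemma green_im (hA : IsSelfAdjoint A) (e : H) {z : ℂ} (hz : z.im ≠ 0) :
    (green A e z).im = z.im * ‖resolvent A z e‖ ^ 2 := by
  set u := resolvent A z e with hu
  have h := smul_sub_resolvent_apply hA hz e
  rw [← hu] at h
  have hr : (inner ℂ (A u) u : ℂ).im = 0 := by
    have h1 : starRingEnd ℂ (inner ℂ (A u) u) = inner ℂ (A u) u := by
      rw [inner_conj_symm, inner_apply_comm hA]
    exact Complex.conj_eq_iff_im.1 h1
  rw [green, ← hu]
  nth_rewrite 1 [← h]
  have huu : inner ℂ u u = ((‖u‖ ^ 2 : ℝ) : ℂ) := by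
    rw [inner_self_eq_norm_sq_to_K]
    norm_cast
  rw [inner_sub_left, inner_smul_left, huu]
  simp only [Complex.neg_im, Complex.sub_im, hr, Complex.mul_im, Complex.conj_re, Complex.conj_im,
    Complex.ofReal_re, Complex.ofReal_im]
  ring

lemma isHerglotz_green (hA : IsSelfAdjoint A) {e : H} (he : e ≠ 0) : IsHerglotz (green A e) where
  differentiableOn z hz := by
    have h := spectrum.hasDerivAt_resolvent_const_left (mem_resolventSet_of_isSelfAdjoint hA
      (ne_of_gt (show 0 < z.im from hz)))
    have h1 : DifferentiableAt ℂ (fun z => innerSL ℂ e (resolvent A z e)) z :=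
      (innerSL ℂ e).differentiableAt.comp z
        (h.differentiableAt.clm_apply (differentiableAt_const e))
    exact h1.neg.differentiableWithinAt
  im_pos z hz := by
    rw [green_im hA e hz.ne']
    have : resolvent A z e ≠ 0 := fun h0 => he <| by
      simpa [h0] using (smul_sub_resolvent_apply hA hz.ne' e).symm
    positivity

/-- The Green function at one end of a bridge, in terms of those of the two sides. -/
lemma green_eq_of_rank_two_perturbation (hA : IsSelfAdjoint A) (hA' : IsSelfAdjoint A') {e₁ e₂ : H}
    (hAA' : ∀ u, A u = A' u + (inner ℂ e₂ u : ℂ) • e₁ + (inner ℂ e₁ u : ℂ) • e₂) {z : ℂ}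
    (hz : z.im ≠ 0) (h₁₂ : inner ℂ e₁ (resolvent A' z e₂) = (0 : ℂ))
    (h₂₁ : inner ℂ e₂ (resolvent A' z e₁) = (0 : ℂ)) :
    green A e₁ z = green A' e₁ z * (1 + green A e₁ z * green A' e₂ z) := by
  set u := resolvent A z e₁ with hu
  have h := smul_sub_resolvent_apply hA hz e₁
  rw [← hu, hAA' u] at h
  have h' : u = resolvent A' z ((1 + (inner ℂ e₂ u : ℂ)) • e₁ + (inner ℂ e₁ u : ℂ) • e₂) := by
    refine eq_resolvent_apply hA' hz ?_
    linear_combination (norm := module) h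
  rw [map_add, map_smul, map_smul] at h'
  have k₁ := congrArg (fun w => (inner ℂ e₁ w : ℂ)) h'
  have k₂ := congrArg (fun w => (inner ℂ e₂ w : ℂ)) h'
  simp only [inner_add_right, inner_smul_right, h₁₂, h₂₁, mul_zero, add_zero, zero_add] at k₁ k₂
  simp only [green, ← hu]
  linear_combination (-1 : ℂ) * k₁ - (inner ℂ e₁ (resolvent A' z e₁) : ℂ) * k₂

end Green

lemma im_le_of_bridge_relations {m₁ m₂ h f : ℂ} {M : ℝ} (hm₁ : 0 < m₁.im) (hm₂ : 0 < m₂.im)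
    (hh : 0 < h.im) (hf : 0 < f.im) (e₁ : m₁ = h * (1 + m₁ * f)) (e₂ : m₂ = f * (1 + m₂ * h))
    (b₁ : ‖-m₁⁻¹‖ ≤ M) (bh : ‖h‖ ≤ M) (bf : ‖-f⁻¹‖ ≤ M) (b₂ : ‖m₂‖ ≤ M) :
    m₂.im ≤ 2 * M ^ 6 * m₁.im := by
  have ne : ∀ {w : ℂ}, 0 < w.im → w ≠ 0 := fun hw h0 => by simp [h0] at hw
  have n₁ := ne hm₁
  have n₂ := ne hm₂
  have nh := ne hh
  have nf := ne hf
  have hM : 0 ≤ M := (norm_nonneg _).trans bh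
  have r₁ : -m₁⁻¹ = -h⁻¹ + f := by
    field_simp
    linear_combination e₁
  have r₂ : -m₂⁻¹ = -f⁻¹ + h := by
    field_simp
    linear_combination e₂
  have inv_im : ∀ {w : ℂ}, w ≠ 0 → (-w⁻¹).im * ‖w‖ ^ 2 = w.im ∧ w.im * ‖-w⁻¹‖ ^ 2 = (-w⁻¹).im := by
    intro w hw
    have : Complex.normSq w ≠ 0 := by simpa using hw
    rw [norm_neg, norm_inv, inv_pow, ← Complex.normSq_eq_norm_sq]
    simp only [Complex.neg_im, Complex.inv_im]
    constructor <;> field_simp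
  have pos : ∀ {w : ℂ}, 0 < w.im → 0 ≤ (-w⁻¹).im := fun hw => by
    rw [← (inv_im (ne hw)).2]; positivity
  have i₁ := congrArg Complex.im r₁
  have i₂ := congrArg Complex.im r₂
  rw [Complex.add_im] at i₁ i₂
  have sq : ∀ {w : ℂ}, ‖w‖ ≤ M → ‖w‖ ^ 2 ≤ M ^ 2 := fun hw => by gcongr
  have s₁ : (-m₁⁻¹).im ≤ m₁.im * M ^ 2 := by
    rw [← (inv_im n₁).2]; exact mul_le_mul_of_nonneg_left (sq b₁) hm₁.le
  have s₂ : h.im ≤ (-h⁻¹).im * M ^ 2 := by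
    rw [← (inv_im nh).1]; exact mul_le_mul_of_nonneg_left (sq bh) (pos hh)
  have s₃ : (-f⁻¹).im ≤ f.im * M ^ 2 := by
    rw [← (inv_im nf).2]; exact mul_le_mul_of_nonneg_left (sq bf) hf.le
  have s₄ : m₂.im ≤ (-m₂⁻¹).im * M ^ 2 := by
    rw [← (inv_im n₂).1]; exact mul_le_mul_of_nonneg_left (sq b₂) (pos hm₂)
  have hM2 : 0 ≤ M ^ 2 := sq_nonneg M
  have t₂ : h.im ≤ m₁.im * M ^ 2 * M ^ 2 :=
    s₂.trans (mul_le_mul_of_nonneg_right (by linarith) hM2)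
  have t₃ : (-f⁻¹).im ≤ m₁.im * M ^ 2 * M ^ 2 :=
    s₃.trans (mul_le_mul_of_nonneg_right (by linarith [pos hh]) hM2)
  calc m₂.im ≤ (-m₂⁻¹).im * M ^ 2 := s₄
    _ ≤ (m₁.im * M ^ 2 * M ^ 2 + m₁.im * M ^ 2 * M ^ 2) * M ^ 2 :=
      mul_le_mul_of_nonneg_right (by linarith) hM2
    _ = _ := by ring

section Moments

variable {H : Type*} [NormedAddCommGroup H] [InnerProductSpace ℂ H]
  {A : H →L[ℂ] H} {e : H} {μ : Measure ℝ}

lemma isSelfAdjoint_aeval_map [CompleteSpace H] (hA : IsSelfAdjoint A) (p : Polynomial ℝ) :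
    IsSelfAdjoint (Polynomial.aeval A (p.map (algebraMap ℝ ℂ))) := by
  induction p using Polynomial.induction_on' with
  | add p q hp hq => simpa using hp.add hq
  | monomial n a =>
    rw [Polynomial.map_monomial, Polynomial.aeval_monomial, ← Algebra.smul_def]
    exact IsSelfAdjoint.smul (by simp [IsSelfAdjoint]) (hA.pow n)

lemma integrable_of_continuous_of_support [IsFiniteMeasure μ] {C : ℝ} (hC : μ {x | C < |x|} = 0)
    {g : ℝ → ℝ} (hg : Continuous g) : Integrable g μ := by
  obtain ⟨B, hB⟩ := (isCompact_Icc (a := -C) (b := C)).exists_bound_of_continuousOn hg.continuousOn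
  refine Integrable.of_bound hg.aestronglyMeasurable B ?_
  have : ∀ᵐ x ∂μ, ¬ C < |x| := by rw [ae_iff]; simpa using hC
  filter_upwards [this] with x hx
  exact hB x (abs_le.1 (not_lt.1 hx))

lemma inner_aeval_eq_integral [IsFiniteMeasure μ] {C : ℝ} (hC : μ {x | C < |x|} = 0)
    (hm : ∀ n : ℕ, inner ℂ e ((A ^ n) e) = ((∫ x, x ^ n ∂μ : ℝ) : ℂ)) (p : Polynomial ℝ) :
    inner ℂ e (Polynomial.aeval A (p.map (algebraMap ℝ ℂ)) e) =
      ((∫ x, p.eval x ∂μ : ℝ) : ℂ) := by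
  induction p using Polynomial.induction_on' with
  | add p q hp hq =>
    simp only [Polynomial.map_add, map_add, add_apply, inner_add_right, hp, hq,
      Polynomial.eval_add]
    rw [integral_add (integrable_of_continuous_of_support hC p.continuous)
      (integrable_of_continuous_of_support hC q.continuous)]
    push_cast
    rfl
  | monomial n a =>
    rw [Polynomial.map_monomial, Polynomial.aeval_monomial, ← Algebra.smul_def,
      smul_apply, inner_smul_right, hm]
    simp [integral_const_mul]

/-- The imaginary part of the Green function is the Poisson integral of the spectral measure. -/
lemma integral_poisson_eq_green_im [CompleteSpace H] (hA : IsSelfAdjoint A) [IsFiniteMeasure μ]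
    {C : ℝ} (hC : μ {x | C < |x|} = 0)
    (hm : ∀ n : ℕ, inner ℂ e ((A ^ n) e) = ((∫ x, x ^ n ∂μ : ℝ) : ℂ)) (x : ℝ) {y : ℝ}
    (hy : 0 < y) :
    ∫ t, y / ((t - x) ^ 2 + y ^ 2) ∂μ = (green A e (x + y * Complex.I)).im := by
  set z : ℂ := x + y * Complex.I with hzdef
  have hzim : z.im = y := by simp [hzdef]
  have hzim' : (starRingEnd ℂ z).im ≠ 0 := by simp [hzim, hy.ne']
  rw [green_im hA e (by rw [hzim]; exact hy.ne'), hzim]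
  set u := resolvent A z e with hu
  have hue := smul_sub_resolvent_apply hA (by rw [hzim]; exact hy.ne') e
  rw [← hu] at hue
  set w := resolvent A (starRingEnd ℂ z) u with hw
  have hwu := smul_sub_resolvent_apply hA hzim' u
  rw [← hw] at hwu
  set d : ℝ → ℝ := fun t => (t - x) ^ 2 + y ^ 2 with hd
  have hdy : ∀ t, y ^ 2 ≤ d t := fun t => by simp only [hd]; nlinarith [sq_nonneg (t - x)]
  have hdpos : ∀ t, 0 < d t := fun t => (by positivity : 0 < y ^ 2).trans_le (hdy t)
  have hdc : Continuous d := by fun_prop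
  have hdic : Continuous fun t => (d t)⁻¹ := hdc.inv₀ fun t => (hdpos t).ne'
  obtain ⟨K, hK⟩ := (isCompact_Icc (a := -C) (b := C)).exists_bound_of_continuousOn hdc.continuousOn
  set K' := max K 1 with hK'
  have hK'pos : 0 < K' := by positivity
  have hsupp : ∀ᵐ t ∂μ, t ∈ Set.Icc (-C) C := by
    have : ∀ᵐ t ∂μ, ¬ C < |t| := by rw [ae_iff]; simpa using hC
    filter_upwards [this] with t ht using abs_le.1 (not_lt.1 ht)
  set D : Polynomial ℝ := (Polynomial.X - Polynomial.C x) ^ 2 + Polynomial.C (y ^ 2) with hD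
  have hDeval : ∀ t, D.eval t = d t := fun t => by simp [hD, hd]
  have hDw : Polynomial.aeval A (D.map (algebraMap ℝ ℂ)) w = e := by
    rw [← hue, ← hwu]
    have hz1 : z = x + y * Complex.I := rfl
    have hz2 : starRingEnd ℂ z = x - y * Complex.I := by simp [hz1, sub_eq_add_neg]
    have hI : Complex.I * Complex.I = -1 := Complex.I_mul_I
    rw [hz2, hz1]
    have hmap : Polynomial.aeval A (D.map (algebraMap ℝ ℂ)) =
        (A - (x : ℂ) • 1) * (A - (x : ℂ) • 1) + ((y : ℂ) * y) • 1 := by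
      simp [hD, pow_two, Algebra.algebraMap_eq_smul_one, mul_smul]
    rw [hmap]
    simp only [add_apply, mul_apply_eq_comp, sub_apply, smul_apply, one_apply_eq_self, map_smul,
      map_sub]
    match_scalars
    · ring
    · ring
    · linear_combination (y : ℂ) ^ 2 * hI
  have hew : inner ℂ e w = ((‖u‖ ^ 2 : ℝ) : ℂ) := by
    rw [← hue, inner_sub_left, inner_smul_left, inner_apply_comm hA, ← inner_smul_right,
      ← inner_sub_right, hwu, inner_self_eq_norm_sq_to_K]
    norm_cast
  have hint : ∀ {g : ℝ → ℝ}, Continuous g → Integrable g μ :=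
    fun hg => integrable_of_continuous_of_support hC hg
  have main : ∀ η : ℝ, 0 < η → |‖u‖ ^ 2 - ∫ t, (d t)⁻¹ ∂μ| ≤
      η * (‖w‖ * √(μ.real Set.univ) + (y ^ 2)⁻¹ * μ.real Set.univ) := by
    intro η hη
    obtain ⟨p, hp⟩ := exists_polynomial_near_of_continuousOn (-C) C _ hdic.continuousOn (η / K')
      (by positivity)
    set q : Polynomial ℝ := 1 - D * p with hq
    have hqb : ∀ t ∈ Set.Icc (-C) C, |q.eval t| ≤ η := by
      intro t ht
      have h1 : q.eval t = -(d t * (p.eval t - (d t)⁻¹)) := by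
        simp only [hq, Polynomial.eval_sub, Polynomial.eval_one, Polynomial.eval_mul, hDeval]
        field_simp [(hdpos t).ne']
        ring
      rw [h1, abs_neg, abs_mul]
      have h2 : |d t| ≤ K' := (hK t ht).trans (le_max_left _ _)
      calc |d t| * |p.eval t - (d t)⁻¹| ≤ K' * (η / K') := by
            gcongr
            exact (hp t ht).le
        _ = η := by field_simp
    set Q := Polynomial.aeval A (q.map (algebraMap ℝ ℂ)) with hQ
    have hQs : IsSelfAdjoint Q := isSelfAdjoint_aeval_map hA q
    have hQnorm : ‖Q e‖ ≤ η * √(μ.real Set.univ) := by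
      have h1 : ((‖Q e‖ ^ 2 : ℝ) : ℂ) = ((∫ t, (q * q).eval t ∂μ : ℝ) : ℂ) := by
        rw [← inner_aeval_eq_integral hC hm (q * q), Polynomial.map_mul, map_mul,
          mul_apply_eq_comp, ← hQ, ← inner_apply_comm hQs,
          inner_self_eq_norm_sq_to_K]
        norm_cast
      have h2 : ‖Q e‖ ^ 2 ≤ η ^ 2 * μ.real Set.univ := by
        rw [Complex.ofReal_injective h1]
        calc ∫ t, (q * q).eval t ∂μ ≤ ∫ _, η ^ 2 ∂μ := by
              refine integral_mono_ae (hint (q * q).continuous) (integrable_const _) ?_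
              filter_upwards [hsupp] with t ht
              have := hqb t ht
              rw [Polynomial.eval_mul, ← pow_two]
              exact sq_le_sq' (abs_le.1 this).1 (abs_le.1 this).2
          _ = _ := by simp [mul_comm]
      refine le_of_sq_le_sq ?_ (by positivity)
      rw [mul_pow, Real.sq_sqrt measureReal_nonneg]
      exact h2
    have h3 : inner ℂ w (Q e) = ((‖u‖ ^ 2 - ∫ t, p.eval t ∂μ : ℝ) : ℂ) := by
      have h4 : Q e = e - Polynomial.aeval A (D.map (algebraMap ℝ ℂ))
          (Polynomial.aeval A (p.map (algebraMap ℝ ℂ)) e) := by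
        simp [hQ, hq]
      rw [h4, inner_sub_right, ← inner_apply_comm (isSelfAdjoint_aeval_map hA D), hDw,
        inner_aeval_eq_integral hC hm, ← inner_conj_symm, hew, Complex.conj_ofReal]
      push_cast
      rfl
    have h5 : |‖u‖ ^ 2 - ∫ t, p.eval t ∂μ| ≤ ‖w‖ * (η * √(μ.real Set.univ)) := by
      rw [← Real.norm_eq_abs, ← Complex.norm_real, ← h3]
      exact (norm_inner_le_norm _ _).trans (by gcongr)
    have h6 : |(∫ t, p.eval t ∂μ) - ∫ t, (d t)⁻¹ ∂μ| ≤ η * (y ^ 2)⁻¹ * μ.real Set.univ := by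
      rw [← integral_sub (hint p.continuous) (hint hdic), ← Real.norm_eq_abs]
      refine norm_integral_le_of_norm_le_const ?_
      filter_upwards [hsupp] with t ht
      have h1 : p.eval t - (d t)⁻¹ = -(q.eval t * (d t)⁻¹) := by
        simp only [hq, Polynomial.eval_sub, Polynomial.eval_one, Polynomial.eval_mul, hDeval]
        field_simp [(hdpos t).ne']
        ring
      rw [h1, norm_neg, norm_mul, Real.norm_eq_abs, Real.norm_eq_abs, abs_inv,
        abs_of_pos (hdpos t)]
      gcongr
      · exact hqb t ht
      · exact hdy t
    calc _ ≤ |‖u‖ ^ 2 - ∫ t, p.eval t ∂μ| + |(∫ t, p.eval t ∂μ) - ∫ t, (d t)⁻¹ ∂μ| :=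
          abs_sub_le _ _ _
      _ ≤ _ := (add_le_add h5 h6).trans_eq (by ring)
  have hzero : ‖u‖ ^ 2 = ∫ t, (d t)⁻¹ ∂μ := by
    set B := ‖w‖ * √(μ.real Set.univ) + (y ^ 2)⁻¹ * μ.real Set.univ
    have hB : 0 ≤ B := by positivity
    rw [← sub_eq_zero, ← abs_nonpos_iff]
    refine le_of_forall_pos_le_add fun η hη => ?_
    refine (main (η / (B + 1)) (by positivity)).trans ?_
    rw [zero_add, div_mul_eq_mul_div, div_le_iff₀ (by positivity)]
    nlinarith
  rw [hzero, ← integral_const_mul]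
  simp only [hd, div_eq_mul_inv]

end Moments

section Differentiation

open scoped Topology

variable {μ : Measure ℝ}

lemma poisson_le_tsum {ε : ℝ} (hε : 0 < ε) (s : ℝ) :
    ENNReal.ofReal (ε / (s ^ 2 + ε ^ 2)) ≤
      ∑' k : ℕ, (Set.Iic (2 ^ k * ε)).indicator (fun _ => ENNReal.ofReal (4 / (4 ^ k * ε))) s := by
  have hex : ∃ k : ℕ, s ≤ 2 ^ k * ε := by
    obtain ⟨k, hk⟩ := pow_unbounded_of_one_lt (s / ε) (one_lt_two (α := ℝ))
    exact ⟨k, ((div_lt_iff₀ hε).1 hk).le⟩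
  classical
  set k := Nat.find hex with hk
  refine le_trans ?_ (ENNReal.le_tsum k)
  rw [Set.indicator_of_mem (show s ∈ Set.Iic (2 ^ k * ε) from Nat.find_spec hex)]
  refine ENNReal.ofReal_le_ofReal ?_
  rw [div_le_div_iff₀ (by positivity) (by positivity)]
  rcases Nat.eq_zero_or_pos k with h0 | hpos
  · rw [h0]
    nlinarith [sq_nonneg s, sq_nonneg ε]
  · obtain ⟨j, hj⟩ := Nat.exists_eq_succ_of_ne_zero hpos.ne'
    have hlt : 2 ^ j * ε < s := not_le.1 (Nat.find_min hex (m := j) (by omega))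
    have h4 : (4 : ℝ) ^ k = 4 * (2 ^ j) ^ 2 := by
      rw [hj, pow_succ, ← pow_mul, mul_comm j 2, pow_mul]; norm_num [mul_comm]
    have hsq : (2 ^ j * ε) ^ 2 ≤ s ^ 2 := by gcongr
    rw [h4]
    nlinarith [sq_nonneg ε]

/-- Poisson integrals vanish in the limit at points where the measure has density zero. -/
lemma tendsto_integral_poisson_zero [IsFiniteMeasure μ] {x : ℝ}
    (hx : Tendsto (fun r => μ.real (Metric.closedBall x r) / r) (𝓝[>] 0) (𝓝 0)) :
    Tendsto (fun ε => ∫ t, ε / ((t - x) ^ 2 + ε ^ 2) ∂μ) (𝓝[>] 0) (𝓝 0) := by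
  set θ : ℝ → ℝ := fun r => μ.real (Metric.closedBall x r) / r with hθ
  have hθ0 : ∀ r, 0 < r → 0 ≤ θ r := fun r hr => by positivity
  obtain ⟨B, hB⟩ : ∃ B, ∀ r, 0 < r → θ r ≤ B := by
    obtain ⟨δ, hδ, h⟩ := mem_nhdsGT_iff_exists_Ioo_subset.1
      (hx.eventually (gt_mem_nhds (zero_lt_one (α := ℝ))))
    have hδ0 : 0 < δ := hδ
    refine ⟨1 + μ.real Set.univ / δ, fun r hr => ?_⟩
    rcases lt_or_ge r δ with hrδ | hrδ
    · have h1 : θ r < 1 := h ⟨hr, hrδ⟩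
      have : 0 ≤ μ.real Set.univ / δ := by positivity
      linarith
    · have h1 : θ r ≤ μ.real Set.univ / δ :=
        div_le_div₀ measureReal_nonneg (measureReal_mono (Set.subset_univ _)) hδ0 hrδ
      linarith
  have hterm : ∀ ε : ℝ, 0 < ε → ∀ k : ℕ,
      ENNReal.ofReal (4 / (4 ^ k * ε)) * μ (Metric.closedBall x (2 ^ k * ε)) =
        ENNReal.ofReal (4 * (1 / 2) ^ k * θ (2 ^ k * ε)) := by
    intro ε hε k
    rw [← ofReal_measureReal, ← ENNReal.ofReal_mul (by positivity)]
    congr 1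
    have h4 : (4 : ℝ) ^ k = 2 ^ k * 2 ^ k := by rw [← mul_pow]; norm_num
    simp only [hθ, h4, one_div, inv_pow]
    field_simp
  have hsum : ∀ ε : ℝ, 0 < ε → Summable fun k : ℕ => 4 * (1 / 2) ^ k * θ (2 ^ k * ε) := by
    intro ε hε
    refine Summable.of_nonneg_of_le (fun k => mul_nonneg (by positivity) (hθ0 _ (by positivity)))
      (fun k => mul_le_mul_of_nonneg_left (hB _ (by positivity)) (by positivity))
      ((summable_geometric_two.mul_left 4).mul_right B)
  have hle : ∀ ε : ℝ, 0 < ε → ∫ t, ε / ((t - x) ^ 2 + ε ^ 2) ∂μ ≤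
      ∑' k : ℕ, 4 * (1 / 2) ^ k * θ (2 ^ k * ε) := by
    intro ε hε
    have hcont : Continuous fun t : ℝ => ε / ((t - x) ^ 2 + ε ^ 2) :=
      continuous_const.div (by fun_prop) fun t => by positivity
    rw [integral_eq_lintegral_of_nonneg_ae (Eventually.of_forall fun t => by positivity)
      hcont.aestronglyMeasurable]
    refine ENNReal.toReal_le_of_le_ofReal (tsum_nonneg fun k =>
      mul_nonneg (by positivity) (hθ0 _ (by positivity))) ?_
    calc ∫⁻ t, ENNReal.ofReal (ε / ((t - x) ^ 2 + ε ^ 2)) ∂μ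
        ≤ ∫⁻ t, ∑' k : ℕ, (Metric.closedBall x (2 ^ k * ε)).indicator
            (fun _ => ENNReal.ofReal (4 / (4 ^ k * ε))) t ∂μ := by
          refine lintegral_mono fun t => ?_
          have := poisson_le_tsum hε |t - x|
          rw [sq_abs] at this
          refine this.trans_eq (tsum_congr fun k => ?_)
          simp only [Set.indicator, Set.mem_Iic, Metric.mem_closedBall, Real.dist_eq]
      _ = ∑' k : ℕ, ENNReal.ofReal (4 * (1 / 2) ^ k * θ (2 ^ k * ε)) := by
          rw [lintegral_tsum fun k =>
            (measurable_const.indicator measurableSet_closedBall).aemeasurable]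
          refine tsum_congr fun k => ?_
          rw [lintegral_indicator_const measurableSet_closedBall, hterm ε hε]
      _ = _ := (ENNReal.ofReal_tsum_of_nonneg (fun k =>
          mul_nonneg (by positivity) (hθ0 _ (by positivity))) (hsum ε hε)).symm
  have hlim : Tendsto (fun ε => ∑' k : ℕ, 4 * (1 / 2) ^ k * θ (2 ^ k * ε)) (𝓝[>] 0)
      (𝓝 (∑' _ : ℕ, (0 : ℝ))) := by
    refine tendsto_tsum_of_dominated_convergence (bound := fun k : ℕ => 4 * (1 / 2) ^ k * B)
      ((summable_geometric_two.mul_left 4).mul_right B) (fun k => ?_) ?_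
    · have h1 : Tendsto (fun ε : ℝ => 2 ^ k * ε) (𝓝[>] 0) (𝓝[>] 0) := by
        refine tendsto_nhdsWithin_iff.2 ⟨?_, ?_⟩
        · have : Tendsto (fun ε : ℝ => 2 ^ k * ε) (𝓝 0) (𝓝 (2 ^ k * 0)) := by
            exact (continuous_const.mul continuous_id).tendsto 0
          rw [mul_zero] at this
          exact this.mono_left nhdsWithin_le_nhds
        · filter_upwards [self_mem_nhdsWithin] with ε hε
          have : 0 < ε := hε
          exact Set.mem_Ioi.2 (by positivity)
      have h2 := (hx.comp h1).const_mul (4 * (1 / 2) ^ k)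
      rw [mul_zero] at h2
      exact h2
    · filter_upwards [self_mem_nhdsWithin] with ε hε k
      have hε' : 0 < ε := hε
      rw [Real.norm_of_nonneg (mul_nonneg (by positivity) (hθ0 _ (by positivity)))]
      exact mul_le_mul_of_nonneg_left (hB _ (by positivity)) (by positivity)
  rw [tsum_zero] at hlim
  refine tendsto_of_tendsto_of_tendsto_of_le_of_le' tendsto_const_nhds hlim
    ?_ ?_
  · filter_upwards [self_mem_nhdsWithin] with ε hε
    have hε' : 0 < ε := hε
    exact integral_nonneg fun t => by positivity
  · filter_upwards [self_mem_nhdsWithin] with ε hε using hle ε hε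

lemma measureReal_closedBall_div_le_poisson [IsFiniteMeasure μ] (x : ℝ) {ε : ℝ} (hε : 0 < ε) :
    μ.real (Metric.closedBall x ε) / ε ≤ 2 * ∫ t, ε / ((t - x) ^ 2 + ε ^ 2) ∂μ := by
  have hcont : Continuous fun t : ℝ => ε / ((t - x) ^ 2 + ε ^ 2) :=
    continuous_const.div (by fun_prop) fun t => by positivity
  have hint : Integrable (fun t : ℝ => ε / ((t - x) ^ 2 + ε ^ 2)) μ := by
    refine Integrable.of_bound hcont.aestronglyMeasurable (1 / ε) (Eventually.of_forall fun t => ?_)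
    rw [Real.norm_of_nonneg (by positivity), div_le_div_iff₀ (by positivity) hε]
    nlinarith [sq_nonneg (t - x)]
  have h1 : ∫ _ in Metric.closedBall x ε, 1 / (2 * ε) ∂μ ≤
      ∫ t, ε / ((t - x) ^ 2 + ε ^ 2) ∂μ := by
    refine (setIntegral_mono_on (integrable_const _) hint.integrableOn measurableSet_closedBall
      fun t ht => ?_).trans (setIntegral_le_integral hint (Eventually.of_forall fun t => ?_))
    · rw [Metric.mem_closedBall, Real.dist_eq] at ht
      have : (t - x) ^ 2 ≤ ε ^ 2 := sq_le_sq' (abs_le.1 ht).1 (abs_le.1 ht).2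
      rw [div_le_div_iff₀ (by positivity) (by positivity)]
      nlinarith
    · simp only [Pi.zero_apply]
      positivity
  rw [setIntegral_const, smul_eq_mul] at h1
  calc μ.real (Metric.closedBall x ε) / ε
      = 2 * (μ.real (Metric.closedBall x ε) * (1 / (2 * ε))) := by
        field_simp
    _ ≤ _ := by gcongr

lemma ae_tendsto_measureReal_closedBall_div [IsFiniteMeasure μ] :
    ∀ᵐ x : ℝ, Tendsto (fun r => μ.real (Metric.closedBall x r) / r) (𝓝[>] 0)
      (𝓝 (2 * (μ.rnDeriv volume x).toReal)) := by
  filter_upwards [Besicovitch.ae_tendsto_rnDeriv μ volume, μ.rnDeriv_lt_top volume] with x hx hfin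
  have h := ((ENNReal.tendsto_toReal hfin.ne).comp hx).const_mul 2
  refine h.congr' ?_
  filter_upwards [self_mem_nhdsWithin] with r hr
  have hr' : (0 : ℝ) < r := hr
  simp only [Function.comp_apply, Real.volume_closedBall, ENNReal.toReal_div,
    ENNReal.toReal_ofReal (by positivity : 0 ≤ 2 * r), Measure.real]
  field_simp

/-- A measure is singular on an interval as soon as its Poisson integrals accumulate at zero almost
everywhere there. -/
lemma mutuallySingular_restrict_of_frequently_poisson [IsFiniteMeasure μ] {a b : ℝ}
    (h : ∀ᵐ x : ℝ ∂volume.restrict (Set.Ioo a b), ∀ η : ℝ, 0 < η → ∃ᶠ n : ℕ in atTop,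
      ∫ t, (1 / ((n : ℝ) + 1)) / ((t - x) ^ 2 + (1 / ((n : ℝ) + 1)) ^ 2) ∂μ ≤ η) :
    μ.restrict (Set.Ioo a b) ⟂ₘ volume := by
  rw [← Measure.rnDeriv_eq_zero]
  have h0 := (ae_restrict_iff' measurableSet_Ioo).1 h
  filter_upwards [Measure.rnDeriv_restrict μ volume (measurableSet_Ioo (a := a) (b := b)), h0,
    ae_tendsto_measureReal_closedBall_div (μ := μ), μ.rnDeriv_lt_top volume] with x hx h1 h2 hfin
  rw [hx]
  by_cases hmem : x ∈ Set.Ioo a b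
  swap
  · simp [hmem]
  rw [Set.indicator_of_mem hmem, Pi.zero_apply]
  have hn : Tendsto (fun n : ℕ => 1 / ((n : ℝ) + 1)) atTop (𝓝[>] 0) :=
    tendsto_nhdsWithin_iff.2 ⟨tendsto_one_div_add_atTop_nhds_zero_nat,
      Eventually.of_forall fun n => Set.mem_Ioi.2 (by positivity)⟩
  have h3 := h2.comp hn
  have h4 : 2 * (μ.rnDeriv volume x).toReal ≤ 0 := by
    refine le_of_forall_pos_le_add fun η hη => ?_
    rw [zero_add]
    refine le_of_tendsto_of_frequently h3 ((h1 hmem (η / 2) (by positivity)).mono fun n hle => ?_)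
    refine (measureReal_closedBall_div_le_poisson x (by positivity)).trans ?_
    linarith
  have h5 : (μ.rnDeriv volume x).toReal = 0 :=
    le_antisymm (by linarith) ENNReal.toReal_nonneg
  exact (ENNReal.toReal_eq_zero_iff _).1 h5 |>.resolve_right hfin.ne

lemma ae_tendsto_poisson_of_mutuallySingular [IsFiniteMeasure μ] {a b : ℝ}
    (h : μ.restrict (Set.Ioo a b) ⟂ₘ volume) :
    ∀ᵐ x : ℝ ∂volume.restrict (Set.Ioo a b),
      Tendsto (fun ε => ∫ t, ε / ((t - x) ^ 2 + ε ^ 2) ∂μ) (𝓝[>] 0) (𝓝 0) := by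
  rw [ae_restrict_iff' measurableSet_Ioo]
  filter_upwards [Measure.rnDeriv_restrict μ volume (measurableSet_Ioo (a := a) (b := b)),
    h.rnDeriv_ae_eq_zero, ae_tendsto_measureReal_closedBall_div (μ := μ)] with x h1 h2 h3 hmem
  rw [h2, Set.indicator_of_mem hmem, Pi.zero_apply] at h1
  refine tendsto_integral_poisson_zero ?_
  simpa [← h1] using h3

end Differentiation

section Complexification

variable {V : Type*}

lemma lp_norm_le_of_forall_norm_le {E F : V → Type*} [∀ i, NormedAddCommGroup (E i)]
    [∀ i, NormedAddCommGroup (F i)] (f : lp E 2) (g : lp F 2) (h : ∀ i, ‖f i‖ ≤ ‖g i‖) :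
    ‖f‖ ≤ ‖g‖ := by
  have h2 : (0 : ℝ) < (2 : ℝ≥0∞).toReal := by norm_num
  rw [lp.norm_eq_tsum_rpow h2, lp.norm_eq_tsum_rpow h2]
  have hf := (memℓp_gen_iff h2).1 (lp.memℓp f)
  have hg := (memℓp_gen_iff h2).1 (lp.memℓp g)
  have h3 : ∀ i, ‖f i‖ ^ (2 : ℝ≥0∞).toReal ≤ ‖g i‖ ^ (2 : ℝ≥0∞).toReal := fun i =>
    Real.rpow_le_rpow (norm_nonneg _) (h i) h2.le
  exact Real.rpow_le_rpow (tsum_nonneg fun i => by positivity) (hf.tsum_le_tsum h3 hg)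
    (by positivity)

/-- The map on `ℓ²` spaces induced by a contraction applied entrywise. -/
noncomputable def lpMapOfContraction {E F : Type*} [NormedAddCommGroup E] [NormedSpace ℝ E]
    [NormedAddCommGroup F] [NormedSpace ℝ F] (T : E →ₗ[ℝ] F) (hT : ∀ x, ‖T x‖ ≤ ‖x‖) :
    lp (fun _ : V => E) 2 →L[ℝ] lp (fun _ : V => F) 2 :=
  LinearMap.mkContinuous
    { toFun := fun f => ⟨fun i => T (f i), (lp.memℓp f).mono' fun i => hT (f i)⟩
      map_add' := fun f g => by ext i; exact map_add T (f i) (g i)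
      map_smul' := fun c f => by ext i; simp } 1
    fun f => by
      rw [one_mul]
      exact lp_norm_le_of_forall_norm_le _ _ fun i => hT (f i)

/-- The entrywise real part. -/
noncomputable def lpRe : lp (fun _ : V => ℂ) 2 →L[ℝ] lp (fun _ : V => ℝ) 2 :=
  lpMapOfContraction Complex.reLm Complex.abs_re_le_norm

/-- The entrywise imaginary part. -/
noncomputable def lpIm : lp (fun _ : V => ℂ) 2 →L[ℝ] lp (fun _ : V => ℝ) 2 :=
  lpMapOfContraction Complex.imLm Complex.abs_im_le_norm

/-- The inclusion of real into complex sequences. -/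
noncomputable def lpOfReal : lp (fun _ : V => ℝ) 2 →L[ℝ] lp (fun _ : V => ℂ) 2 :=
  lpMapOfContraction Complex.ofRealAm.toLinearMap fun x => (Complex.norm_real x).le

@[simp] lemma lpRe_apply (f : lp (fun _ : V => ℂ) 2) (i : V) : lpRe f i = (f i).re := rfl

@[simp] lemma lpIm_apply (f : lp (fun _ : V => ℂ) 2) (i : V) : lpIm f i = (f i).im := rfl

@[simp] lemma lpOfReal_apply (f : lp (fun _ : V => ℝ) 2) (i : V) :
    lpOfReal f i = ((f i : ℝ) : ℂ) := rfl

lemma lpOfReal_re_add_im (f : lp (fun _ : V => ℂ) 2) :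
    lpOfReal (lpRe f) + Complex.I • lpOfReal (lpIm f) = f := by
  ext i
  change ((f i).re : ℂ) + Complex.I * ((f i).im : ℂ) = f i
  rw [mul_comm, Complex.re_add_im]

lemma inner_lpOfReal (f g : lp (fun _ : V => ℝ) 2) :
    inner ℂ (lpOfReal f) (lpOfReal g) = ((inner ℝ f g : ℝ) : ℂ) := by
  rw [lp.inner_eq_tsum, lp.inner_eq_tsum, Complex.ofReal_tsum]
  refine tsum_congr fun i => ?_
  simp

/-- The complex-linear extension of an operator on real square-summable functions. -/
noncomputable def lpComplexify (T : lp (fun _ : V => ℝ) 2 →L[ℝ] lp (fun _ : V => ℝ) 2) :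
    lp (fun _ : V => ℂ) 2 →L[ℂ] lp (fun _ : V => ℂ) 2 where
  toFun f := lpOfReal (T (lpRe f)) + Complex.I • lpOfReal (T (lpIm f))
  map_add' f g := by simp only [map_add, smul_add]; abel
  map_smul' c f := by
    have hre : lpRe (c • f) = c.re • lpRe f - c.im • lpIm f  := by
      ext i
      exact Complex.mul_re c (f i)
    have him : lpIm (c • f) = c.re • lpIm f + c.im • lpRe f := by
      ext i
      exact Complex.mul_im c (f i)
    rw [hre, him]
    ext i
    simp only [map_sub, map_add, map_smul, lp.coeFn_add, lp.coeFn_sub, lp.coeFn_smul,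
      Pi.add_apply, Pi.sub_apply, Pi.smul_apply, Complex.real_smul, smul_eq_mul, RingHom.id_apply]
    linear_combination ((lpOfReal (T (lpRe f)) i) + Complex.I * (lpOfReal (T (lpIm f)) i)) *
      (Complex.re_add_im c) - c.im * (lpOfReal (T (lpIm f)) i) * Complex.I_sq
  cont := by fun_prop

variable {T : lp (fun _ : V => ℝ) 2 →L[ℝ] lp (fun _ : V => ℝ) 2}

lemma lpComplexify_apply (f : lp (fun _ : V => ℂ) 2) :
    lpComplexify T f = lpOfReal (T (lpRe f)) + Complex.I • lpOfReal (T (lpIm f)) := rfl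

lemma lpComplexify_lpOfReal (f : lp (fun _ : V => ℝ) 2) :
    lpComplexify T (lpOfReal f) = lpOfReal (T f) := by
  have h1 : lpRe (lpOfReal f) = f := by ext i; simp
  have h2 : lpIm (lpOfReal f) = 0 := by ext i; simp
  rw [lpComplexify_apply, h1, h2, map_zero, map_zero, smul_zero, add_zero]

lemma lpComplexify_pow_lpOfReal (n : ℕ) (f : lp (fun _ : V => ℝ) 2) :
    (lpComplexify T ^ n) (lpOfReal f) = lpOfReal ((T ^ n) f) := by
  induction n with
  | zero => simp
  | succ n ih =>
    rw [pow_succ', pow_succ', mul_apply_eq_comp, mul_apply_eq_comp, ih, lpComplexify_lpOfReal]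

lemma isSelfAdjoint_lpComplexify (hT : IsSelfAdjoint T) : IsSelfAdjoint (lpComplexify T) := by
  rw [ContinuousLinearMap.isSelfAdjoint_iff_isSymmetric]
  intro f g
  have h : ∀ a b, (inner ℝ (T a) b : ℝ) = inner ℝ a (T b) := fun a b => hT.isSymmetric a b
  rw [ContinuousLinearMap.coe_coe, lpComplexify_apply f, lpComplexify_apply g]
  conv_lhs => rw [← lpOfReal_re_add_im g]
  conv_rhs => rw [← lpOfReal_re_add_im f]
  simp only [inner_add_left, inner_add_right, inner_smul_left, inner_smul_right, inner_lpOfReal, h]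

lemma lpOfReal_single [DecidableEq V] (v : V) :
    lpOfReal (lp.single 2 v (1 : ℝ)) = lp.single 2 v (1 : ℂ) := by
  ext i
  rw [lpOfReal_apply, lp.single_apply, lp.single_apply]
  by_cases h : i = v
  · subst h; simp
  · simp [h]

lemma lpComplexify_apply_eq_sum {S : V → Finset V} (hT : ∀ f v, T f v = ∑ w ∈ S v, f w)
    (f : lp (fun _ : V => ℂ) 2) (v : V) : lpComplexify T f v = ∑ w ∈ S v, f w := by
  rw [lpComplexify_apply, lp.coeFn_add, Pi.add_apply, lp.coeFn_smul, Pi.smul_apply,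
    lpOfReal_apply, lpOfReal_apply, hT, hT, Complex.ofReal_sum, Complex.ofReal_sum,
    Finset.smul_sum, ← Finset.sum_add_distrib]
  refine Finset.sum_congr rfl fun w _ => ?_
  rw [lpRe_apply, lpIm_apply, smul_eq_mul, mul_comm, Complex.re_add_im]

end Complexification

section Graph

variable {V : Type*} [DecidableEq V]

lemma inner_resolvent_single_eq_zero {G : SimpleGraph V}
    {A : lp (fun _ : V => ℂ) 2 →L[ℂ] lp (fun _ : V => ℂ) 2} (hA : IsSelfAdjoint A)
    {S : V → Finset V} (hS : ∀ v, ∀ w ∈ S v, G.Adj v w) (hAS : ∀ f v, A f v = ∑ w ∈ S v, f w)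
    {u w : V} (huw : ¬ G.Reachable u w) {z : ℂ} (hz : z.im ≠ 0) :
    inner ℂ (lp.single 2 u 1 : lp (fun _ : V => ℂ) 2) (resolvent A z (lp.single 2 w 1)) =
      (0 : ℂ) := by
  classical
  set f := resolvent A z (lp.single 2 w 1) with hf
  have hfe := smul_sub_resolvent_apply hA hz (lp.single 2 w 1)
  rw [← hf] at hfe
  have hfe' : ∀ x, z * f x - ∑ y ∈ S x, f y = if x = w then 1 else 0 := by
    intro x
    rw [← hAS]
    have := congrArg (fun h : lp (fun _ : V => ℂ) 2 => h x) hfe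
    rw [lp.single_apply, Pi.single_apply] at this
    exact this
  let g : lp (fun _ : V => ℂ) 2 := ⟨fun x => if G.Reachable u x then f x else 0,
    (lp.memℓp f).mono' fun x => by split_ifs <;> simp⟩
  have hg : ∀ x, g x = if G.Reachable u x then f x else 0 := fun _ => rfl
  have hge : z • g - A g = 0 := by
    ext x
    change z * g x - A g x = 0
    have hiff : ∀ y ∈ S x, (G.Reachable u y ↔ G.Reachable u x) := fun y hy =>
      ⟨fun h => h.trans (hS x y hy).symm.reachable, fun h => h.trans (hS x y hy).reachable⟩
    rw [hAS, Finset.sum_congr rfl fun y hy => (hg y).trans (if_congr (hiff y hy) rfl rfl), hg]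
    split_ifs with h
    · rw [hfe' x, if_neg]
      rintro rfl
      exact huw h
    · simp
  have hg0 := eq_resolvent_apply hA hz hge
  rw [map_zero] at hg0
  have hfu : f u = 0 := by
    have h1 : g u = 0 := by rw [hg0]; rfl
    rwa [hg, if_pos (SimpleGraph.Reachable.refl u)] at h1
  rw [lp.inner_single_left, hfu, inner_zero_right]

lemma exists_isHerglotz_green_im_le_of_adj {G : SimpleGraph V} (hG : G.IsAcyclic)
    {A : lp (fun _ : V => ℂ) 2 →L[ℂ] lp (fun _ : V => ℂ) 2} (hA : IsSelfAdjoint A)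
    {S : V → Finset V} (hS : ∀ v w, w ∈ S v ↔ G.Adj v w) (hAS : ∀ f v, A f v = ∑ w ∈ S v, f w)
    {u w : V} (huw : G.Adj u w) :
    ∃ 𝓕 : List (ℂ → ℂ), (∀ F ∈ 𝓕, IsHerglotz F) ∧ ∀ (M : ℝ) (z : ℂ), 0 < z.im →
      (∀ F ∈ 𝓕, ‖F z‖ ≤ M) →
        (green A (lp.single 2 w 1) z).im ≤ 2 * M ^ 6 * (green A (lp.single 2 u 1) z).im := by
  set δ : V → lp (fun _ : V => ℂ) 2 := fun v => lp.single 2 v 1 with hδ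
  have hδ0 : ∀ v, δ v ≠ 0 := fun v h => by
    have h1 : δ v v = 0 := by rw [h]; rfl
    simp [hδ, lp.single_apply] at h1
  have hin : ∀ v f, inner ℂ (δ v) f = f v := fun v f => by
    rw [hδ, lp.inner_single_left]; simp
  set A' := A - (innerSL ℂ (δ w)).smulRight (δ u) - (innerSL ℂ (δ u)).smulRight (δ w) with hA'def
  have hAA' : ∀ f, A f = A' f + (inner ℂ (δ w) f : ℂ) • δ u + (inner ℂ (δ u) f : ℂ) • δ w := by
    intro f
    simp only [hA'def, sub_apply, ContinuousLinearMap.smulRight_apply, innerSL_apply_apply]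
    abel
  have hA' : IsSelfAdjoint A' := by
    rw [ContinuousLinearMap.isSelfAdjoint_iff_isSymmetric]
    intro f g
    have h1 : inner ℂ (A f) g = inner ℂ f (A g) := inner_apply_comm hA f g
    have h2 : ∀ f, A' f = A f - (inner ℂ (δ w) f : ℂ) • δ u - (inner ℂ (δ u) f : ℂ) • δ w :=
      fun f => by rw [hAA' f]; abel
    rw [ContinuousLinearMap.coe_coe, h2, h2]
    simp only [inner_sub_left, inner_sub_right, inner_smul_left, inner_smul_right, h1,
      inner_conj_symm]
    ring
  set G' := G.deleteEdges {s(u, w)} with hG'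
  have hbr : ¬ G'.Reachable u w :=
    SimpleGraph.isBridge_iff.1 (SimpleGraph.isAcyclic_iff_forall_adj_isBridge.1 hG huw)
  set S' : V → Finset V := fun v => {y ∈ S v | s(v, y) ≠ s(u, w)} with hS'def
  have hS' : ∀ v, ∀ y ∈ S' v, G'.Adj v y := by
    intro v y hy
    rw [hS'def, Finset.mem_filter, hS] at hy
    rw [hG', SimpleGraph.deleteEdges_adj]
    exact ⟨hy.1, hy.2⟩
  have hne : u ≠ w := huw.ne
  have hAS' : ∀ f v, A' f v = ∑ y ∈ S' v, f y := by
    intro f v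
    have h1 : A f v = A' f v + f w * δ u v + f u * δ w v := by
      rw [hAA' f, hin, hin]
      rfl
    have h2 := Finset.sum_filter_add_sum_filter_not (S v) (fun y => s(v, y) ≠ s(u, w)) (f := f)
    rw [← hAS, h1] at h2
    have h3 : ∑ y ∈ S v with ¬ s(v, y) ≠ s(u, w), f y = f w * δ u v + f u * δ w v := by
      simp only [not_not, hδ, lp.single_apply, Pi.single_apply]
      by_cases hvu : v = u
      · subst hvu
        rw [Finset.sum_eq_single w]
        · simp [hne]
        · intro y hy hyw
          simp [hyw, hne] at hy
        · simp [hS, huw]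
      · by_cases hvw : v = w
        · subst hvw
          rw [Finset.sum_eq_single u]
          · simp [hne.symm]
          · intro y hy hyu
            simp [hyu, hne.symm] at hy
          · intro h
            simp [hS, huw.symm] at h
        · simp [hvu, hvw]
    rw [h3] at h2
    linear_combination -h2
  refine ⟨[fun z => -(green A (δ u) z)⁻¹, green A' (δ u), fun z => -(green A' (δ w) z)⁻¹,
    green A (δ w)], ?_, ?_⟩
  · simp only [List.mem_cons, List.not_mem_nil, or_false, forall_eq_or_imp, forall_eq]
    exact ⟨(isHerglotz_green hA (hδ0 u)).neg_inv, isHerglotz_green hA' (hδ0 u),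
      (isHerglotz_green hA' (hδ0 w)).neg_inv, isHerglotz_green hA (hδ0 w)⟩
  · intro M z hz
    simp only [List.mem_cons, List.not_mem_nil, or_false, forall_eq_or_imp, forall_eq]
    rintro ⟨b₁, bh, bf, b₂⟩
    have h₁₂ := inner_resolvent_single_eq_zero hA' hS' hAS' hbr hz.ne'
    have h₂₁ := inner_resolvent_single_eq_zero hA' hS' hAS' (fun h => hbr h.symm) hz.ne'
    have hAA'' : ∀ f, A f = A' f + (inner ℂ (δ u) f : ℂ) • δ w + (inner ℂ (δ w) f : ℂ) • δ u :=
      fun f => by rw [hAA' f]; abel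
    exact im_le_of_bridge_relations ((isHerglotz_green hA (hδ0 u)).im_pos z hz)
      ((isHerglotz_green hA (hδ0 w)).im_pos z hz) ((isHerglotz_green hA' (hδ0 u)).im_pos z hz)
      ((isHerglotz_green hA' (hδ0 w)).im_pos z hz)
      (green_eq_of_rank_two_perturbation hA hA' hAA' hz.ne' h₁₂ h₂₁)
      (green_eq_of_rank_two_perturbation hA hA' hAA'' hz.ne' h₂₁ h₁₂) b₁ bh bf b₂

/-- Along a path in a tree, the imaginary parts of the diagonal Green functions are comparable
wherever finitely many Herglotz functions are bounded. -/
lemma exists_isHerglotz_green_im_le_of_walk {G : SimpleGraph V} (hG : G.IsAcyclic)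
    {A : lp (fun _ : V => ℂ) 2 →L[ℂ] lp (fun _ : V => ℂ) 2} (hA : IsSelfAdjoint A)
    {S : V → Finset V} (hS : ∀ v w, w ∈ S v ↔ G.Adj v w) (hAS : ∀ f v, A f v = ∑ w ∈ S v, f w)
    {u w : V} (p : G.Walk u w) :
    ∃ 𝓕 : List (ℂ → ℂ), (∀ F ∈ 𝓕, IsHerglotz F) ∧ ∀ (M : ℝ) (z : ℂ), 0 < z.im →
      (∀ F ∈ 𝓕, ‖F z‖ ≤ M) → (green A (lp.single 2 w 1) z).im ≤
        (2 * M ^ 6) ^ p.length * (green A (lp.single 2 u 1) z).im := by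
  induction p with
  | nil => exact ⟨[], by simp, by simp⟩
  | @cons u v w h p ih =>
    obtain ⟨𝓕, h𝓕, ih⟩ := ih
    obtain ⟨𝓖, h𝓖, h1⟩ := exists_isHerglotz_green_im_le_of_adj hG hA hS hAS h
    refine ⟨𝓕 ++ 𝓖, fun F hF => (List.mem_append.1 hF).elim (h𝓕 F) (h𝓖 F), fun M z hz hM => ?_⟩
    have h2 := ih M z hz fun F hF => hM F (List.mem_append_left _ hF)
    have h3 := h1 M z hz fun F hF => hM F (List.mem_append_right _ hF)
    refine h2.trans ?_
    rw [SimpleGraph.Walk.length_cons, pow_succ _ p.length, mul_assoc]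
    have : 0 ≤ (2 * M ^ 6) ^ p.length := by positivity
    gcongr

end Graph

lemma isFiniteMeasure_of_integral_one_ne_zero {μ : Measure ℝ} (h : ∫ _, (1 : ℝ) ∂μ ≠ 0) :
    IsFiniteMeasure μ := by
  refine ⟨lt_top_iff_ne_top.2 fun htop => h ?_⟩
  simp [Measure.real, htop]

/-- Lemma on propagation of singularity from the root: for the Laplacian on an
SH rooted tree with bounded branching, if the spectral measure of the root's delta function is
singular with respect to Lebesgue measure on an interval `(a,b)`, then so is the spectral
measure of every delta function `δ_v`. -/
theorem spectral_measure_singular_on_interval_of_root_singular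
    (L k : ℕ → ℕ)
    (hk : ∀ n, 1 ≤ n → 2 ≤ k n)
    (hLmono : ∀ n, 1 ≤ n → L n < L (n + 1))
    (hbdd : ∃ K : ℕ, ∀ n, k n ≤ K)
    (κ : ℕ → ℕ)
    (hκ1 : ∀ n, 1 ≤ n → κ (L n) = k n)
    (hκ2 : ∀ j : ℕ, (∀ n, 1 ≤ n → L n ≠ j) → κ j = 1)
    (V : Type) [DecidableEq V] (G : SimpleGraph V) (O : V)
    (hconn : G.Connected) (hacyc : G.IsAcyclic)
    (hfin : ∀ v : V, (G.neighborSet v).Finite)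
    (hSH : ∀ v : V, {w | G.Adj v w ∧ G.dist O w = G.dist O v + 1}.ncard = κ (G.dist O v))
    -- the adjacency Laplacian Δ, a bounded self-adjoint operator on ℓ²(V(Γ))
    (Δ : lp (fun _ : V => ℝ) 2 →L[ℝ] lp (fun _ : V => ℝ) 2)
    (hΔ : ∀ (f : lp (fun _ : V => ℝ) 2) (v : V),
      Δ f v = ∑' w : G.neighborSet v, f (w : V))
    (hsa : IsSelfAdjoint Δ)
    -- the interval (a,b)
    (a b : ℝ)
    -- μO, the spectral measure of Δ and δ_O
    (μO : Measure ℝ)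
    (hμOc : ∃ C : ℝ, μO {x : ℝ | C < |x|} = 0)
    (hμOm : ∀ n : ℕ, ∫ x, x ^ n ∂μO =
      ⟪(lp.single 2 O 1 : lp (fun _ : V => ℝ) 2), (Δ ^ n) (lp.single 2 O 1)⟫)
    -- assumption: the a.c. part of μO vanishes on (a,b)
    (hsing : μO.restrict (Set.Ioo a b) ⟂ₘ volume)
    -- an arbitrary vertex v and the spectral measure of Δ and δ_v
    (v : V) (μv : Measure ℝ)
    (hμvc : ∃ C : ℝ, μv {x : ℝ | C < |x|} = 0)
    (hμvm : ∀ n : ℕ, ∫ x, x ^ n ∂μv =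
      ⟪(lp.single 2 v 1 : lp (fun _ : V => ℝ) 2), (Δ ^ n) (lp.single 2 v 1)⟫) :
    μv.restrict (Set.Ioo a b) ⟂ₘ volume := by
  classical
  have hμ : ∀ (u : V) (μ : Measure ℝ), (∀ n : ℕ, ∫ x, x ^ n ∂μ =
      ⟪(lp.single 2 u 1 : lp (fun _ : V => ℝ) 2), (Δ ^ n) (lp.single 2 u 1)⟫) →
      IsFiniteMeasure μ ∧ ∀ n : ℕ, inner ℂ (lp.single 2 u 1 : lp (fun _ : V => ℂ) 2)
        ((lpComplexify Δ ^ n) (lp.single 2 u 1)) = ((∫ x, x ^ n ∂μ : ℝ) : ℂ) := by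
    intro u μ h
    refine ⟨isFiniteMeasure_of_integral_one_ne_zero ?_, fun n => ?_⟩
    · have h0 := h 0
      simp only [pow_zero, one_apply_eq_self, lp.inner_single_left] at h0
      rw [h0]
      simp
    · rw [← lpOfReal_single, lpComplexify_pow_lpOfReal, inner_lpOfReal, h]
  obtain ⟨_, hmO⟩ := hμ O μO hμOm
  obtain ⟨_, hmv⟩ := hμ v μv hμvm
  obtain ⟨_, hCO⟩ := hμOc
  obtain ⟨_, hCv⟩ := hμvc
  have hA := isSelfAdjoint_lpComplexify hsa
  set S : V → Finset V := fun u => (hfin u).toFinset with hSdef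
  have hS : ∀ u w, w ∈ S u ↔ G.Adj u w := fun u w => by simp [hSdef]
  have hΔS : ∀ f u, Δ f u = ∑ w ∈ S u, f w := by
    intro f u
    rw [hΔ, ← Finset.tsum_subtype]
    have : (S u : Set V) = G.neighborSet u := (hfin u).coe_toFinset
    exact congrArg (fun s : Set V => ∑' w : s, f w) this.symm
  obtain ⟨p⟩ := hconn.preconnected O v
  obtain ⟨𝓕, h𝓕, hle⟩ := exists_isHerglotz_green_im_le_of_walk hacyc hA hS
    (lpComplexify_apply_eq_sum hΔS) p
  refine mutuallySingular_restrict_of_frequently_poisson ?_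
  filter_upwards [ae_tendsto_poisson_of_mutuallySingular hsing,
    ae_frequently_norm_le_of_isHerglotz 𝓕 h𝓕 a b] with x hx ⟨M, hM⟩ η hη
  have hn : Tendsto (fun n : ℕ => 1 / ((n : ℝ) + 1)) atTop (nhdsWithin 0 (Set.Ioi 0)) :=
    tendsto_nhdsWithin_iff.2 ⟨tendsto_one_div_add_atTop_nhds_zero_nat,
      Eventually.of_forall fun n => Set.mem_Ioi.2 (by positivity)⟩
  have hlim := (hx.comp hn).const_mul ((2 * M ^ 6) ^ p.length)
  rw [mul_zero] at hlim
  refine (hM.and_eventually (hlim.eventually (gt_mem_nhds hη))).mono fun n ⟨hbound, hsmall⟩ => ?_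
  have hpos : 0 < 1 / ((n : ℝ) + 1) := by positivity
  rw [Function.comp_apply, integral_poisson_eq_green_im hA hCO hmO x hpos] at hsmall
  rw [integral_poisson_eq_green_im hA hCv hmv x hpos]
  exact (hle M _ (by simpa only [Complex.add_im, Complex.ofReal_im,
    Complex.im_ofReal_mul, Complex.I_im, mul_one, zero_add] using hpos) hbound).trans hsmall.le
end

section
/- Let (R_m) be a strictly increasing sequence of natural numbers with R_{m+1} − R_m ≥ 2 for all sufficiently large m. Let a(j) = ρ_m if j = R_m for some m and a(j) = 1 otherwise, and b ≡ 0, where ρ_m ≥ δ for some fixed δ > 0 and the sequence (ρ_m) is unbounded. Then every finite Borel measure μ on ℝ for which the polynomials {E ↦ u_{1,E}(j)}_{j≥1} form an orthonormal system in L²(μ) is singular with respect to Lebesgue measure. -/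
open MeasureTheory Filter
open scoped ENNReal

/-- `u1sol a b E` is the solution `u_{1,E}` of the eigenvalue equation
`a(j)u(j+1) + a(j-1)u(j-1) + b(j)u(j) = E u(j)` (for all `j ≥ 1`) with
`u(0) = 0`, `u(1) = 1`. -/
noncomputable def u1sol (a b : ℕ → ℝ) (E : ℝ) : ℕ → ℝ
  | 0 => 0
  | 1 => 1
  | (j + 2) => ((E - b (j + 1)) * u1sol a b E (j + 1) - a j * u1sol a b E j) / a (j + 1)

/-- The Cauchy transform of the discrete measure with weights `c i` at the points `x i`. -/
noncomputable def cauchySum {ι : Type*} [Fintype ι] (c x : ι → ℝ) (z : ℂ) : ℂ :=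
  ∑ i, (c i : ℂ) / (z - x i)

section CauchySum

variable {ι : Type*} [Fintype ι] {c x : ι → ℝ}

lemma cauchySum_ofReal (E : ℝ) :
    cauchySum c x (E : ℂ) = ((∑ i, c i / (E - x i) : ℝ) : ℂ) := by
  simp [cauchySum]

lemma cauchySum_im_nonpos (hc : ∀ i, 0 ≤ c i) {z : ℂ} (hz : 0 ≤ z.im) :
    (cauchySum c x z).im ≤ 0 := by
  rw [cauchySum, Complex.im_sum]
  refine Finset.sum_nonpos fun i _ ↦ ?_
  rw [Complex.div_im]
  simp only [Complex.ofReal_im, zero_mul, zero_div, Complex.ofReal_re, Complex.sub_im, sub_zero,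
    zero_sub, Left.neg_nonpos_iff]
  exact div_nonneg (mul_nonneg (hc i) hz) (Complex.normSq_nonneg _)

lemma norm_cauchySum_le (hc : ∀ i, 0 ≤ c i) {z : ℂ} {d : ℝ} (hd : 0 < d)
    (hz : ∀ i, d ≤ ‖z - x i‖) : ‖cauchySum c x z‖ ≤ (∑ i, c i) / d := by
  rw [cauchySum, Finset.sum_div]
  refine (norm_sum_le _ _).trans (Finset.sum_le_sum fun i _ ↦ ?_)
  rw [norm_div, Complex.norm_real, Real.norm_of_nonneg (hc i)]
  exact div_le_div_of_nonneg_left (hc i) hd (hz i)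

lemma differentiableAt_cauchySum {z : ℂ} (hz : ∀ i, z ≠ x i) :
    DifferentiableAt ℂ (cauchySum c x) z := by
  unfold cauchySum
  refine DifferentiableAt.fun_sum fun i _ ↦ ?_
  exact (differentiableAt_const _).div (by fun_prop) (sub_ne_zero.2 (hz i))

end CauchySum

/-- A Möbius map taking the closed lower half-plane into the closed unit disc. -/
noncomputable def lowerToDisc (t : ℝ) (w : ℂ) : ℂ := Complex.I * w / (t + Complex.I * w)

section LowerToDisc

variable {t : ℝ} {w : ℂ}

lemma le_norm_add_I_mul (hw : w.im ≤ 0) : t ≤ ‖(t : ℂ) + Complex.I * w‖ := by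
  refine le_trans ?_ (Complex.re_le_norm _)
  simp
  linarith

lemma add_I_mul_ne_zero (ht : 0 < t) (hw : w.im ≤ 0) : (t : ℂ) + Complex.I * w ≠ 0 :=
  norm_pos_iff.1 (ht.trans_le (le_norm_add_I_mul hw))

lemma norm_lowerToDisc_le (ht : 0 < t) (hw : w.im ≤ 0) : ‖lowerToDisc t w‖ ≤ ‖w‖ / t := by
  rw [lowerToDisc, norm_div, norm_mul, Complex.norm_I, one_mul]
  exact div_le_div_of_nonneg_left (norm_nonneg _) ht (le_norm_add_I_mul hw)

lemma lowerToDisc_re_nonneg (ht : 0 < t) (hw : w.im ≤ 0) : 0 ≤ (lowerToDisc t w).re := by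
  rw [lowerToDisc, Complex.div_re, ← add_div]
  refine div_nonneg ?_ (Complex.normSq_nonneg _)
  simp
  nlinarith [sq_nonneg w.re, sq_nonneg w.im]

lemma lowerToDisc_ofReal_re (t r : ℝ) : (lowerToDisc t r).re = r ^ 2 / (t ^ 2 + r ^ 2) := by
  rw [lowerToDisc, Complex.div_re]
  simp [Complex.normSq_apply]
  ring

lemma differentiableAt_lowerToDisc (ht : 0 < t) (hw : w.im ≤ 0) :
    DifferentiableAt ℂ (lowerToDisc t) w := by
  unfold lowerToDisc
  exact DifferentiableAt.div (by fun_prop) (by fun_prop) (add_I_mul_ne_zero ht hw)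

end LowerToDisc

section Boole

variable {ι : Type*} [Fintype ι] {c x : ι → ℝ}

lemma ne_ofReal_of_im_pos {z : ℂ} (hz : 0 < z.im) (r : ℝ) : z ≠ r := by
  rintro rfl
  simp at hz

lemma norm_integral_lowerToDisc_cauchySum_le (hc : ∀ i, 0 ≤ c i) {t R η : ℝ} (ht : 0 < t)
    (hR : 0 < R) (hx : ∀ i, |x i| ≤ R / 2) (hη : 0 < η) :
    ‖∫ E in (-R)..R, lowerToDisc t (cauchySum c x (E + η * Complex.I))‖ ≤ 8 * (∑ i, c i) / t := by
  set f : ℂ → ℂ := fun z ↦ lowerToDisc t (cauchySum c x z) with hf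
  have hdiff : ∀ z : ℂ, 0 < z.im → DifferentiableAt ℂ f z := fun z hz ↦
    (differentiableAt_lowerToDisc ht (cauchySum_im_nonpos hc hz.le)).comp z
      (differentiableAt_cauchySum fun i ↦ ne_ofReal_of_im_pos hz _)
  have hbound : ∀ z : ℂ, 0 < z.im → (R ≤ |z.re| ∨ R ≤ z.im) →
      ‖f z‖ ≤ 2 * (∑ i, c i) / (R * t) := by
    intro z hz h
    have hd : ∀ i, R / 2 ≤ ‖z - x i‖ := by
      intro i
      rcases h with h | h
      · refine le_trans ?_ (Complex.abs_re_le_norm _)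
        have := abs_sub_abs_le_abs_sub z.re (x i)
        have := hx i
        simp only [Complex.sub_re, Complex.ofReal_re]
        linarith
      · refine le_trans ?_ (Complex.abs_im_le_norm _)
        simp only [Complex.sub_im, Complex.ofReal_im, sub_zero]
        exact le_trans (by linarith) (le_abs_self _)
    refine (norm_lowerToDisc_le ht (cauchySum_im_nonpos hc hz.le)).trans ?_
    have := norm_cauchySum_le hc (half_pos hR) hd
    calc _ ≤ (∑ i, c i) / (R / 2) / t := by gcongr
      _ = _ := by field_simp
  have key := Complex.integral_boundary_rect_eq_zero_of_differentiableOn f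
    (⟨-R, η⟩ : ℂ) (⟨R, η + R⟩ : ℂ) (by
      intro z hz
      refine (hdiff z ?_).differentiableWithinAt
      have := hz.2
      simp only [Set.mem_preimage, Set.mem_uIcc] at this
      rcases this with h | h <;> linarith [h.1])
  simp only at key
  have h1 : ‖∫ E in (-R)..R, f (E + (η + R : ℝ) * Complex.I)‖
      ≤ 2 * (∑ i, c i) / (R * t) * |R - -R| := by
    refine intervalIntegral.norm_integral_le_of_norm_le_const fun E _ ↦ hbound _ ?_ (Or.inr ?_)
    · simp; linarith
    · simp; linarith
  have h2 : ∀ r : ℝ, |r| = R → ‖Complex.I • ∫ y in η..(η + R), f (r + y * Complex.I)‖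
      ≤ 2 * (∑ i, c i) / (R * t) * |η + R - η| := by
    intro r hr
    rw [norm_smul, Complex.norm_I, one_mul]
    refine intervalIntegral.norm_integral_le_of_norm_le_const fun y hy ↦
      hbound _ ?_ (Or.inl ?_)
    · rw [Set.uIoc_of_le (by linarith)] at hy
      simp; linarith [hy.1]
    · simp [hr]
  have h3 := h2 R (abs_of_pos hR)
  have h4 := h2 (-R) (by rw [abs_neg, abs_of_pos hR])
  have hsum : 2 * (∑ i, c i) / (R * t) * |R - -R| + 2 * (∑ i, c i) / (R * t) * |η + R - η|
      + 2 * (∑ i, c i) / (R * t) * |η + R - η| = 8 * (∑ i, c i) / t := by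
    rw [show R - -R = 2 * R by ring, show η + R - η = R by ring, abs_of_pos hR,
      abs_of_pos (by linarith)]
    field_simp
    ring
  rw [← hsum]
  have heq : (∫ E in (-R)..R, f (E + η * Complex.I))
      = (∫ E in (-R)..R, f (E + (η + R : ℝ) * Complex.I))
        - (Complex.I • ∫ y in η..(η + R), f (R + y * Complex.I))
        + (Complex.I • ∫ y in η..(η + R), f ((-R : ℝ) + y * Complex.I)) := by
    linear_combination key
  rw [heq]
  refine (norm_add_le _ _).trans ?_
  gcongr
  refine (norm_sub_le _ _).trans ?_
  gcongr

/-- A weak-type bound, uniform in the poles, for finite sums of simple poles with nonnegative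
weights. -/
lemma volume_le_abs_sum_div_sub_le (hc : ∀ i, 0 ≤ c i) {t : ℝ} (ht : 0 < t) (M : ℝ) :
    volume {E : ℝ | |E| ≤ M ∧ (∀ i, E ≠ x i) ∧ t ≤ |∑ i, c i / (E - x i)|}
      ≤ ENNReal.ofReal (16 * (∑ i, c i) / t) := by
  obtain ⟨R, hR0, hRM, hRx⟩ : ∃ R : ℝ, 0 < R ∧ M < R ∧ ∀ i, |x i| ≤ R / 2 := by
    refine ⟨|M| + 2 * (∑ i, |x i|) + 1, by positivity, ?_, fun i ↦ ?_⟩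
    · have := le_abs_self M
      have : 0 ≤ ∑ i, |x i| := by positivity
      linarith
    · have := Finset.single_le_sum (f := fun i ↦ |x i|) (fun j _ ↦ abs_nonneg _)
        (Finset.mem_univ i)
      have := abs_nonneg M
      linarith
  set η : ℕ → ℝ := fun k ↦ 1 / ((k : ℝ) + 1) with hη
  have hηpos : ∀ k, 0 < η k := fun k ↦ Nat.one_div_pos_of_nat
  set g : ℕ → ℝ → ℂ := fun k E ↦ lowerToDisc t (cauchySum c x (E + η k * Complex.I)) with hg
  have him : ∀ k (E : ℝ), 0 < ((E : ℂ) + η k * Complex.I).im := by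
    intro k E
    simpa using hηpos k
  have hgcont : ∀ k, Continuous (g k) := by
    intro k
    refine continuous_iff_continuousAt.2 fun E ↦ ?_
    have h1 := (differentiableAt_lowerToDisc ht
      (cauchySum_im_nonpos (x := x) hc (him k E).le)).continuousAt
    have h2 := (differentiableAt_cauchySum (c := c) (x := x)
      fun i ↦ ne_ofReal_of_im_pos (him k E) _).continuousAt
    exact ContinuousAt.comp (f := fun E : ℝ ↦ cauchySum c x (E + η k * Complex.I)) h1
      (ContinuousAt.comp (f := fun E : ℝ ↦ (E : ℂ) + η k * Complex.I) h2 (by fun_prop))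
  have hgre : ∀ k E, 0 ≤ (g k E).re := fun k E ↦
    lowerToDisc_re_nonneg ht (cauchySum_im_nonpos hc (him k E).le)
  have hint : ∀ k, ∫⁻ E in Set.Ioc (-R) R, ENNReal.ofReal (g k E).re
      ≤ ENNReal.ofReal (8 * (∑ i, c i) / t) := by
    intro k
    have hi : IntervalIntegrable (g k) volume (-R) R := (hgcont k).intervalIntegrable _ _
    have hi' := (intervalIntegrable_iff_integrableOn_Ioc_of_le (by linarith)).1 hi
    have hre : Integrable (fun E ↦ (g k E).re) (volume.restrict (Set.Ioc (-R) R)) := hi'.re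
    rw [← ofReal_integral_eq_lintegral_ofReal hre (Eventually.of_forall (hgre k))]
    refine ENNReal.ofReal_le_ofReal ?_
    refine le_trans ?_ (norm_integral_lowerToDisc_cauchySum_le hc ht hR0 hRx (hηpos k))
    rw [intervalIntegral.integral_of_le (by linarith)]
    refine le_trans (le_of_eq ?_) (Complex.re_le_norm _)
    exact integral_re hi'
  have hmeas : ∀ k, Measurable fun E ↦ ENNReal.ofReal (g k E).re := fun k ↦
    (Complex.continuous_re.comp (hgcont k)).measurable.ennreal_ofReal
  have hfatou : ∫⁻ E in Set.Ioc (-R) R, liminf (fun k ↦ ENNReal.ofReal (g k E).re) atTop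
      ≤ ENNReal.ofReal (8 * (∑ i, c i) / t) := by
    refine (lintegral_liminf_le hmeas).trans ?_
    exact (liminf_le_liminf (Eventually.of_forall hint)).trans (by simp)
  have hmarkov := mul_meas_ge_le_lintegral (μ := volume.restrict (Set.Ioc (-R) R))
    (Measurable.liminf hmeas) (1 / 2)
  have hsub : {E : ℝ | |E| ≤ M ∧ (∀ i, E ≠ x i) ∧ t ≤ |∑ i, c i / (E - x i)|} ⊆
      {E | 1 / 2 ≤ liminf (fun k ↦ ENNReal.ofReal (g k E).re) atTop} ∩ Set.Ioc (-R) R := by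
    rintro E ⟨hEM, hEx, hEt⟩
    have hE := abs_le.1 hEM
    refine ⟨?_, by linarith, by linarith⟩
    have hlim : Tendsto (fun k ↦ (g k E).re) atTop
        (nhds (lowerToDisc t (cauchySum c x E)).re) := by
      have h0 : Tendsto (fun k ↦ (E : ℂ) + η k * Complex.I) atTop (nhds (E : ℂ)) := by
        have : Tendsto (fun k ↦ (η k : ℂ)) atTop (nhds ((0 : ℝ) : ℂ)) :=
          (Complex.continuous_ofReal.tendsto 0).comp tendsto_one_div_add_atTop_nhds_zero_nat
        simpa using (this.mul_const Complex.I).const_add (E : ℂ)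
      have h1 := (differentiableAt_cauchySum (c := c) (x := x) (z := E)
        fun i ↦ by exact_mod_cast hEx i).continuousAt
      have h2 := (differentiableAt_lowerToDisc ht (cauchySum_im_nonpos (x := x) hc
        (z := E) (by simp))).continuousAt
      exact (Complex.continuous_re.tendsto _).comp (h2.tendsto.comp (h1.tendsto.comp h0))
    have hlim' := (ENNReal.continuous_ofReal.tendsto _).comp hlim
    have hval : 1 / 2 ≤ (lowerToDisc t (cauchySum c x E)).re := by
      rw [cauchySum_ofReal, lowerToDisc_ofReal_re]
      have : t ^ 2 ≤ (∑ i, c i / (E - x i)) ^ 2 := by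
        rw [← sq_abs (∑ i, c i / (E - x i))]
        gcongr
      rw [div_le_div_iff₀ (by norm_num) (by positivity)]
      linarith
    simp only [Set.mem_ofPred_eq]
    have := hlim'.liminf_eq
    simp only [Function.comp_def] at this
    rw [this]
    calc (1 / 2 : ℝ≥0∞) = ENNReal.ofReal (1 / 2) := by
          rw [ENNReal.ofReal_div_of_pos (by norm_num)]; simp
      _ ≤ _ := ENNReal.ofReal_le_ofReal hval
  rw [Measure.restrict_apply (measurableSet_le measurable_const (Measurable.liminf hmeas))]
    at hmarkov
  have h12 := (mul_le_mul_right (measure_mono (μ := volume) hsub) (1 / 2 : ℝ≥0∞)).trans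
    (hmarkov.trans hfatou)
  calc _ = 2 * (1 / 2 * volume _) := by
        rw [← mul_assoc, one_div, ENNReal.mul_inv_cancel (by simp) (by simp), one_mul]
    _ ≤ 2 * ENNReal.ofReal (8 * (∑ i, c i) / t) := by gcongr
    _ = ENNReal.ofReal (16 * (∑ i, c i) / t) := by
        rw [show (2 : ℝ≥0∞) = ENNReal.ofReal 2 by simp, ← ENNReal.ofReal_mul (by norm_num)]
        congr 1
        ring

end Boole

lemma u1sol_recurrence {a : ℕ → ℝ} (ha : ∀ j, 0 < a j) (E : ℝ) (j : ℕ) :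
    a (j + 1) * u1sol a 0 E (j + 2) + a j * u1sol a 0 E j = E * u1sol a 0 E (j + 1) := by
  have := (ha (j + 1)).ne'
  rw [u1sol]
  simp only [Pi.zero_apply, sub_zero]
  field_simp
  ring

lemma continuous_u1sol (a : ℕ → ℝ) : ∀ j, Continuous fun E ↦ u1sol a 0 E j
  | 0 => by simpa only [u1sol] using continuous_const
  | 1 => by simpa only [u1sol] using continuous_const
  | (j + 2) => by
    have h1 := continuous_u1sol a (j + 1)
    have h0 := continuous_u1sol a j
    simp only [u1sol, Pi.zero_apply, sub_zero]
    fun_prop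

section JacobiMatrix

/-- The truncated Jacobi matrix with zero diagonal and off-diagonal entries `a 1, a 2, …`. -/
def jacobiMatrix (a : ℕ → ℝ) (n : ℕ) : Matrix (Fin n) (Fin n) ℝ := fun i j ↦
  if (j : ℕ) = i + 1 then a j else if (i : ℕ) = j + 1 then a i else 0

lemma jacobiMatrix_isHermitian (a : ℕ → ℝ) (n : ℕ) : (jacobiMatrix a n).IsHermitian := by
  ext i j
  simp only [Matrix.conjTranspose_apply, jacobiMatrix, star_trivial]
  split_ifs with h1 h2 h2 <;> first | rfl | omega

lemma jacobiMatrix_mulVec_u1sol {a : ℕ → ℝ} (ha : ∀ j, 0 < a j) (n : ℕ) (E : ℝ)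
    (i : Fin (n + 1)) :
    (jacobiMatrix a (n + 1)).mulVec (fun j ↦ u1sol a 0 E (j + 1)) i =
      E * u1sol a 0 E (i + 1) -
        if (i : ℕ) = n then a (n + 1) * u1sol a 0 E (n + 2) else 0 := by
  have hsplit : ∀ j : ℕ,
      (if j = (i : ℕ) + 1 then a j else if (i : ℕ) = j + 1 then a i else 0) *
        u1sol a 0 E (j + 1) =
      (if j = (i : ℕ) + 1 then a (i + 1) * u1sol a 0 E (i + 2) else 0) +
        if (i : ℕ) = j + 1 then a i * u1sol a 0 E i else 0 := by
    intro j
    split_ifs with h1 h2 h2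
    · omega
    · subst h1; simp
    · rw [h2]; simp
    · simp
  simp only [Matrix.mulVec, dotProduct, jacobiMatrix]
  rw [Fin.sum_univ_eq_sum_range (fun j ↦
    (if j = (i : ℕ) + 1 then a j else if (i : ℕ) = j + 1 then a i else 0) *
      u1sol a 0 E (j + 1)) (n + 1)]
  simp_rw [hsplit]
  rw [Finset.sum_add_distrib, Finset.sum_ite_eq']
  have hi := i.2
  have hrec := u1sol_recurrence ha E i
  have hlow : (∑ j ∈ Finset.range (n + 1), if (i : ℕ) = j + 1 then a i * u1sol a 0 E i else 0)
      = a i * u1sol a 0 E i := by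
    rcases Nat.eq_zero_or_pos (i : ℕ) with h0 | h0
    · simp [h0, u1sol]
    · rw [Finset.sum_eq_single ((i : ℕ) - 1)]
      · rw [if_pos (by omega)]
      · intro j _ hj
        rw [if_neg (by omega)]
      · intro h
        exact absurd (Finset.mem_range.2 (by omega)) h
  rw [hlow]
  by_cases h : (i : ℕ) = n
  · rw [if_neg (by simp [h]), if_pos h, ← hrec, h]
    ring
  · rw [if_pos (Finset.mem_range.2 (by omega)), if_neg h, ← hrec]
    ring

/-- Up to the factor `a (n + 1)`, the reciprocal of `u_{1,E}(n + 2)` is the Green function of the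
truncated Jacobi matrix between its two end points. -/
lemma exists_inv_u1sol_eq_sum {a : ℕ → ℝ} (ha : ∀ j, 0 < a j) (n : ℕ) :
    ∃ c x : Fin (n + 1) → ℝ, ∑ i, |c i| ≤ 1 ∧ ∀ E, (∀ i, E ≠ x i) →
      a (n + 1) * u1sol a 0 E (n + 2) * ∑ i, c i / (E - x i) = 1 := by
  set hJ := jacobiMatrix_isHermitian a (n + 1)
  set φ := hJ.eigenvectorBasis
  have hcoord : ∀ k : Fin (n + 1), ∑ i, φ i k ^ 2 = 1 := by
    intro k
    have := φ.sum_sq_norm_inner_right (EuclideanSpace.single k (1 : ℝ))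
    simpa [EuclideanSpace.inner_single_right] using this
  refine ⟨fun i ↦ φ i 0 * φ i (Fin.last n), hJ.eigenvalues, ?_, fun E hE ↦ ?_⟩
  · calc ∑ i, |φ i 0 * φ i (Fin.last n)|
        ≤ ∑ i, (φ i 0 ^ 2 / 2 + φ i (Fin.last n) ^ 2 / 2) := by
          refine Finset.sum_le_sum fun i _ ↦ ?_
          rw [abs_le]
          constructor <;>
            nlinarith [sq_nonneg (φ i 0 + φ i (Fin.last n)), sq_nonneg (φ i 0 - φ i (Fin.last n))]
      _ = 1 := by
          rw [Finset.sum_add_distrib, ← Finset.sum_div, ← Finset.sum_div, hcoord, hcoord]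
          norm_num
  · set U : Fin (n + 1) → ℝ := fun j ↦ u1sol a 0 E (j + 1) with hU
    have hdot : ∀ i, (E - hJ.eigenvalues i) * (φ i ⬝ᵥ U) =
        a (n + 1) * u1sol a 0 E (n + 2) * φ i (Fin.last n) := by
      intro i
      have h1 : φ i ⬝ᵥ (jacobiMatrix a (n + 1)).mulVec U = hJ.eigenvalues i * (φ i ⬝ᵥ U) := by
        rw [Matrix.dotProduct_mulVec, ← Matrix.mulVec_transpose]
        have : (jacobiMatrix a (n + 1)).transpose = jacobiMatrix a (n + 1) := by
          simpa [Matrix.conjTranspose_eq_transpose_of_trivial] using hJ.eq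
        rw [this, hJ.mulVec_eigenvectorBasis, smul_dotProduct, smul_eq_mul]
      have h2 : φ i ⬝ᵥ (jacobiMatrix a (n + 1)).mulVec U =
          E * (φ i ⬝ᵥ U) - a (n + 1) * u1sol a 0 E (n + 2) * φ i (Fin.last n) := by
        simp only [dotProduct, hU, jacobiMatrix_mulVec_u1sol ha, mul_sub, Finset.sum_sub_distrib,
          Finset.mul_sum]
        congr 1
        · exact Finset.sum_congr rfl fun j _ ↦ by ring
        · rw [Finset.sum_eq_single (Fin.last n)]
          · simp; ring
          · intro j _ hj
            rw [if_neg, mul_zero]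
            exact fun h ↦ hj (Fin.ext h)
          · simp
      linarith
    have hexp : ∑ i, (φ i ⬝ᵥ U) * φ i 0 = 1 := by
      have := congrArg (fun v : EuclideanSpace ℝ (Fin (n + 1)) ↦ v 0)
        (φ.sum_repr' (WithLp.toLp 2 U))
      simp [hU, u1sol] at this
      rw [← this]
      refine Finset.sum_congr rfl fun i _ ↦ ?_
      simp [PiLp.inner_apply, dotProduct, hU, mul_comm]
    rw [← hexp, Finset.mul_sum]
    refine Finset.sum_congr rfl fun i _ ↦ ?_
    have hne : E - hJ.eigenvalues i ≠ 0 := sub_ne_zero.2 (hE i)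
    field_simp
    linear_combination (-(φ i 0)) * hdot i

end JacobiMatrix

lemma volume_abs_u1sol_lt_le {a : ℕ → ℝ} (ha : ∀ j, 0 < a j) {n : ℕ} (hn : a (n + 1) = 1)
    {ε : ℝ} (hε : 0 < ε) (M : ℝ) :
    volume {E : ℝ | |E| ≤ M ∧ |u1sol a 0 E (n + 2)| < ε} ≤ ENNReal.ofReal (64 * ε) := by
  obtain ⟨c, x, hc, hsum⟩ := exists_inv_u1sol_eq_sum ha n
  set S : (Fin (n + 1) → ℝ) → Set ℝ := fun d ↦
    {E : ℝ | |E| ≤ M ∧ (∀ i, E ≠ x i) ∧ 1 / (2 * ε) ≤ |∑ i, d i / (E - x i)|} with hS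
  have hvol : ∀ d : Fin (n + 1) → ℝ, (∀ i, 0 ≤ d i) → (∀ i, d i ≤ |c i|) →
      volume (S d) ≤ ENNReal.ofReal (32 * ε) := by
    intro d hd hdc
    refine (volume_le_abs_sum_div_sub_le hd (by positivity) M).trans
      (ENNReal.ofReal_le_ofReal ?_)
    have : ∑ i, d i ≤ 1 := (Finset.sum_le_sum fun i _ ↦ hdc i).trans hc
    calc 16 * (∑ i, d i) / (1 / (2 * ε)) = 32 * ε * ∑ i, d i := by field_simp; ring
      _ ≤ 32 * ε * 1 := by gcongr
      _ = 32 * ε := mul_one _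
  have hsub : {E : ℝ | |E| ≤ M ∧ |u1sol a 0 E (n + 2)| < ε} ⊆
      Set.range x ∪ (S (fun i ↦ max (c i) 0) ∪ S (fun i ↦ max (-c i) 0)) := by
    rintro E ⟨hEM, hEu⟩
    by_cases hEx : ∀ i, E ≠ x i
    swap
    · push Not at hEx
      obtain ⟨i, hi⟩ := hEx
      exact Or.inl ⟨i, hi.symm⟩
    right
    have h1 := hsum E hEx
    rw [hn, one_mul] at h1
    have hsplit : ∑ i, c i / (E - x i) =
        ∑ i, max (c i) 0 / (E - x i) - ∑ i, max (-c i) 0 / (E - x i) := by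
      rw [← Finset.sum_sub_distrib]
      refine Finset.sum_congr rfl fun i _ ↦ ?_
      rw [← sub_div]
      congr 1
      rcases le_total 0 (c i) with h | h
      · rw [max_eq_left h, max_eq_right (by linarith), sub_zero]
      · rw [max_eq_right h, max_eq_left (by linarith), zero_sub, neg_neg]
    have hlarge : 1 / ε ≤ |∑ i, c i / (E - x i)| := by
      rw [div_le_iff₀ hε, ← abs_one, ← h1, abs_mul, mul_comm]
      gcongr
    by_contra hcon
    simp only [Set.mem_union, hS, Set.mem_ofPred_eq, not_or, not_and, not_le] at hcon
    have h2 := hcon.1 hEM hEx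
    have h3 := hcon.2 hEM hEx
    rw [hsplit] at hlarge
    have h4 := abs_sub (∑ i, max (c i) 0 / (E - x i)) (∑ i, max (-c i) 0 / (E - x i))
    have h5 : 1 / ε = 1 / (2 * ε) + 1 / (2 * ε) := by field_simp; norm_num
    linarith
  refine (measure_mono hsub).trans ?_
  refine (measure_union_le _ _).trans ?_
  rw [(Set.finite_range x).measure_zero, zero_add]
  refine (measure_union_le _ _).trans ?_
  rw [show 64 * ε = 32 * ε + 32 * ε by ring, ENNReal.ofReal_add (by positivity) (by positivity)]
  exact add_le_add
    (hvol _ (fun i ↦ le_max_right _ _) fun i ↦ max_le (le_abs_self _) (abs_nonneg _))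
    (hvol _ (fun i ↦ le_max_right _ _) fun i ↦ max_le (neg_le_abs _) (abs_nonneg _))

lemma measure_le_abs_u1sol_le {a : ℕ → ℝ} (ha : ∀ j, 0 < a j) {μ : Measure ℝ}
    [IsFiniteMeasure μ] (hnorm : ∀ i : ℕ, 1 ≤ i → ∫ E, u1sol a 0 E i * u1sol a 0 E i ∂μ = 1)
    {n : ℕ} (hn : a (n + 1) = 1) {ε : ℝ} (hε : 0 < ε) (M : ℝ) :
    μ {E : ℝ | |E| ≤ M ∧ ε ≤ |u1sol a 0 E n|}
      ≤ ENNReal.ofReal (2 * (M ^ 2 + 1) / (a n * ε) ^ 2) := by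
  have hint : ∀ i : ℕ, 1 ≤ i → Integrable (fun E ↦ u1sol a 0 E i * u1sol a 0 E i) μ := by
    intro i hi
    by_contra h
    have := hnorm i hi
    rw [integral_undef h] at this
    exact zero_ne_one this
  set f : ℝ → ℝ := fun E ↦ 2 * (M ^ 2 * (u1sol a 0 E (n + 1) * u1sol a 0 E (n + 1)) +
    u1sol a 0 E (n + 2) * u1sol a 0 E (n + 2)) with hf
  have i1 := (hint (n + 1) (by omega)).const_mul (M ^ 2)
  have i2 := hint (n + 2) (by omega)
  have hfi : Integrable f μ := (i1.add i2).const_mul 2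
  have hf0 : ∀ E, 0 ≤ f E := fun E ↦ by
    have h1 := mul_self_nonneg (u1sol a 0 E (n + 1))
    have h2 := mul_self_nonneg (u1sol a 0 E (n + 2))
    simp only [hf]
    positivity
  have hfval : ∫ E, f E ∂μ = 2 * (M ^ 2 + 1) := by
    simp only [hf]
    rw [integral_const_mul, integral_add i1 i2, integral_const_mul, hnorm _ (by omega),
      hnorm _ (by omega), mul_one]
  have hmarkov := mul_meas_ge_le_integral_of_nonneg (Eventually.of_forall hf0) hfi
    ((a n * ε) ^ 2)
  rw [hfval] at hmarkov
  have hpos : 0 < (a n * ε) ^ 2 := by have := ha n; positivity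
  have hsub : {E : ℝ | |E| ≤ M ∧ ε ≤ |u1sol a 0 E n|} ⊆ {E | (a n * ε) ^ 2 ≤ f E} := by
    rintro E ⟨hEM, hEu⟩
    have hrec := u1sol_recurrence ha E n
    rw [hn, one_mul] at hrec
    have hE2 : E ^ 2 ≤ M ^ 2 := by
      rw [← sq_abs E]
      gcongr
    have han := ha n
    have h1 : (a n * ε) ^ 2 ≤ (a n * u1sol a 0 E n) ^ 2 := by
      rw [mul_pow, mul_pow, ← sq_abs (u1sol a 0 E n)]
      gcongr
    have h2 : a n * u1sol a 0 E n = E * u1sol a 0 E (n + 1) - u1sol a 0 E (n + 2) := by linarith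
    rw [h2] at h1
    refine h1.trans ?_
    simp only [hf]
    nlinarith [sq_nonneg (E * u1sol a 0 E (n + 1) + u1sol a 0 E (n + 2)),
      mul_le_mul_of_nonneg_right hE2 (sq_nonneg (u1sol a 0 E (n + 1)))]
  refine (measure_mono hsub).trans ?_
  rw [← ofReal_measureReal]
  refine ENNReal.ofReal_le_ofReal ?_
  rw [le_div_iff₀ hpos, mul_comm]
  exact hmarkov

/-- A Borel–Cantelli criterion for mutual singularity. -/
lemma mutuallySingular_of_tsum_ne_top {α : Type*} [MeasurableSpace α] {μ ν : Measure α}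
    {B K : ℕ → Set α} (hB : ∀ k, MeasurableSet (B k)) (hK : ∀ x, ∀ᶠ k in atTop, x ∈ K k)
    (hν : ∑' k, ν (K k ∩ B k) ≠ ∞) (hμ : ∑' k, μ (K k \ B k) ≠ ∞) : μ ⟂ₘ ν := by
  refine Measure.MutuallySingular.symm
    ⟨limsup B atTop, MeasurableSet.measurableSet_limsup hB, ?_, ?_⟩
  · refine measure_mono_null ?_ (measure_limsup_atTop_eq_zero hν)
    intro x hx
    rw [mem_limsup_iff_frequently_mem] at hx ⊢
    exact (hx.and_eventually (hK x)).mono fun k hk ↦ ⟨hk.2, hk.1⟩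
  · refine measure_mono_null ?_ (measure_limsup_atTop_eq_zero hμ)
    intro x hx
    rw [Set.mem_compl_iff, mem_limsup_iff_frequently_mem, not_frequently] at hx
    rw [mem_limsup_iff_frequently_mem]
    exact ((hK x).and hx).frequently

/-- Lemma: sparse Jacobi matrices with unbounded bumps have purely singular
spectral measure: if `a(j) = ρ_m ≥ δ > 0` at `j = R_m` and `a(j) = 1` otherwise, with
`(R_m)` strictly increasing, `R_{m+1} - R_m ≥ 2` for large `m`, and `(ρ_m)` unbounded, then
the measure of orthonormality of the polynomials `u_{1,E}(j)` (i.e. the spectral measure of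
`J(a,0)` and `δ_1`) is singular with respect to Lebesgue measure. -/
theorem singular_of_unbounded_sparse_bumps
    (R : ℕ → ℕ) (hmono : StrictMono R) (hR1 : ∀ m, 1 ≤ R m)
    (hgap : ∃ M₀ : ℕ, ∀ m, M₀ ≤ m → 2 ≤ R (m + 1) - R m)
    (ρ : ℕ → ℝ) (δ : ℝ) (hδ : 0 < δ) (hρ : ∀ m, δ < ρ m)
    (hunb : ∀ C : ℝ, ∃ m, C < ρ m)
    (a : ℕ → ℝ) (ha0 : a 0 = 1)
    (haR : ∀ m, a (R m) = ρ m)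
    (ha1 : ∀ j, 1 ≤ j → (∀ m, R m ≠ j) → a j = 1)
    (μ : Measure ℝ) [IsFiniteMeasure μ]
    (horth : ∀ i j : ℕ, 1 ≤ i → 1 ≤ j →
      ∫ E, u1sol a 0 E i * u1sol a 0 E j ∂μ = if i = j then 1 else 0) :
    μ ⟂ₘ volume := by
  have hpos : ∀ j, 0 < a j := by
    intro j
    rcases Nat.eq_zero_or_pos j with rfl | hj
    · rw [ha0]; exact one_pos
    by_cases h : ∃ m, R m = j
    · obtain ⟨m, rfl⟩ := h
      rw [haR]
      exact hδ.trans (hρ m)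
    · push Not at h
      rw [ha1 j hj h]
      exact one_pos
  obtain ⟨M₀, hM₀⟩ := hgap
  have hlarge : ∀ C : ℝ, ∃ m, M₀ < m ∧ C < ρ m := by
    intro C
    obtain ⟨m, hm⟩ := hunb (max C (∑ i ∈ Finset.range (M₀ + 1), ρ i))
    refine ⟨m, ?_, (le_max_left _ _).trans_lt hm⟩
    by_contra! hle
    have := Finset.single_le_sum (f := ρ) (s := Finset.range (M₀ + 1))
      (fun i _ ↦ (hδ.trans (hρ i)).le) (Finset.mem_range.2 (Nat.lt_succ_of_le hle))
    exact absurd ((le_max_right _ _).trans_lt hm) (not_lt.2 this)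
  have hbump : ∀ C : ℝ, ∃ n, a (n + 1) = 1 ∧ a (n + 3) = 1 ∧ C < a (n + 2) := by
    intro C
    obtain ⟨m, hm, hC⟩ := hlarge C
    obtain ⟨p, rfl⟩ : ∃ p, m = p + 1 := ⟨m - 1, by omega⟩
    have hgp := hM₀ p (by omega)
    have hgm := hM₀ (p + 1) hm.le
    have hRp := hR1 p
    obtain ⟨n, hn⟩ : ∃ n, R (p + 1) = n + 2 := ⟨R (p + 1) - 2, by omega⟩
    refine ⟨n, ha1 _ (by omega) fun q hq ↦ ?_, ha1 _ (by omega) fun q hq ↦ ?_, ?_⟩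
    · rcases Nat.lt_or_ge p q with h | h
      · have := hmono.monotone (show p + 1 ≤ q from h)
        omega
      · have := hmono.monotone h
        omega
    · rcases Nat.lt_or_ge (p + 1) q with h | h
      · have := hmono.monotone (show p + 1 + 1 ≤ q from h)
        omega
      · have := hmono.monotone h
        omega
    · rwa [← hn, haR]
  have hnorm : ∀ i : ℕ, 1 ≤ i → ∫ E, u1sol a 0 E i * u1sol a 0 E i ∂μ = 1 := fun i hi ↦ by
    simpa using horth i i hi hi
  set ε : ℕ → ℝ := fun k ↦ (1 / 2) ^ k with hε
  have hε0 : ∀ k, 0 < ε k := fun k ↦ by positivity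
  have hεsum : Summable ε := summable_geometric_two
  have hchoose : ∀ k : ℕ, ∃ n, a (n + 1) = 1 ∧ a (n + 3) = 1 ∧
      2 * ((k : ℝ) ^ 2 + 1) / (a (n + 2) * ε k) ^ 2 ≤ ε k := by
    intro k
    have hk := hε0 k
    obtain ⟨n, h1, h3, h2⟩ := hbump (max 1 (2 * ((k : ℝ) ^ 2 + 1) / ε k ^ 3))
    refine ⟨n, h1, h3, ?_⟩
    have h4 := (le_max_left _ _).trans_lt h2
    have h5 := (le_max_right _ _).trans_lt h2
    rw [div_lt_iff₀ (by positivity)] at h5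
    rw [div_le_iff₀ (by positivity)]
    have h6 : a (n + 2) * ε k ^ 3 ≤ a (n + 2) ^ 2 * ε k ^ 3 := by
      gcongr
      nlinarith
    nlinarith
  choose n hn1 hn3 hn2 using hchoose
  refine mutuallySingular_of_tsum_ne_top
    (B := fun k ↦ {E | |u1sol a 0 E (n k + 2)| < ε k}) (K := fun k ↦ {E | |E| ≤ k})
    (fun k ↦ measurableSet_lt (continuous_u1sol a _).abs.measurable measurable_const)
    (fun E ↦ ?_) ?_ ?_
  · filter_upwards [tendsto_natCast_atTop_atTop.eventually_ge_atTop |E|] with k hk using hk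
  · exact ne_top_of_le_ne_top (hεsum.mul_left 64).tsum_ofReal_ne_top
      (ENNReal.tsum_le_tsum fun k ↦ volume_abs_u1sol_lt_le hpos (hn1 k) (hε0 k) k)
  · refine ne_top_of_le_ne_top hεsum.tsum_ofReal_ne_top (ENNReal.tsum_le_tsum fun k ↦ ?_)
    refine (measure_mono ?_).trans ((measure_le_abs_u1sol_le hpos hnorm (hn3 k) (hε0 k) k).trans
      (ENNReal.ofReal_le_ofReal (hn2 k)))
    rintro E ⟨hE, hEu⟩
    exact ⟨hE, not_lt.1 hEu⟩
end
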